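/- Let f : ℝ² → ℝ be smooth with f(0,0) = 0, f_x(0,0) = 0, f_y(0,0) = 0, and let Σ = {(x,y,z) ∈ ℝ³ : z ≤ f(x,y)}. Suppose that for each t ∈ (0,ε) there is a smooth function h(·,·,t) : ℝ² → ℝ, depending smoothly on t, with (G_{t/2} * 1_Σ)(x, y, h(x,y,t)) = 1/2 for all (x,y) near the origin and h(0,0,t) → 0 as t → 0⁺. Then, as t → 0⁺, h_xx(0,0,t) + h_yy(0,0,t) = f_xx + f_yy + (t/2) [ (f_xxxx + 2 f_xxyy + f_yyyy) − 2 (f_xx³ + 3 f_xx f_xy² + 3 f_yy f_xy² + f_yy³) ] + O(t²), where all derivatives of f are evaluated at (0,0). -/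

import Mathlib

/-- Partial derivative in the first variable of a function of two real variables. -/
noncomputable def pdx (g : ℝ → ℝ → ℝ) (x y : ℝ) : ℝ := deriv (fun s => g s y) x

/-- Partial derivative in the second variable of a function of two real variables. -/
noncomputable def pdy (g : ℝ → ℝ → ℝ) (x y : ℝ) : ℝ := deriv (fun s => g x s) y

/-- The Gaussian kernel on `ℝ³` at time `t`. -/
noncomputable def G3 (t : ℝ) (p : ℝ × ℝ × ℝ) : ℝ :=
  (4 * Real.pi * t) ^ (-(3 : ℝ) / 2) * Real.exp (-(p.1 ^ 2 + p.2.1 ^ 2 + p.2.2 ^ 2) / (4 * t))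

/-- Convolution of the Gaussian kernel on `ℝ³` with a function. -/
noncomputable def conv3 (t : ℝ) (u : ℝ × ℝ × ℝ → ℝ) (p : ℝ × ℝ × ℝ) : ℝ :=
  ∫ q : ℝ × ℝ × ℝ, G3 t (p.1 - q.1, p.2.1 - q.2.1, p.2.2 - q.2.2) * u q

namespace MBO
open MeasureTheory ProbabilityTheory Real

/-- The standard Gaussian measure on the plane. -/
noncomputable def mu : Measure (ℝ × ℝ) := (gaussianReal 0 1).prod (gaussianReal 0 1)

instance : IsProbabilityMeasure mu := by unfold mu; infer_instance

/-- standard normal density -/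
noncomputable def g (u : ℝ) : ℝ := (√(2 * π))⁻¹ * exp (-u ^ 2 / 2)

lemma g_eq (u : ℝ) : gaussianPDFReal 0 1 u = g u := by
  simp [gaussianPDFReal, g]

lemma g_pos (u : ℝ) : 0 < g u := by unfold g; positivity

lemma g_cont : Continuous g := by unfold g; fun_prop

lemma g_deriv (u : ℝ) : HasDerivAt g (-u * g u) u := by
  unfold g
  have h1 : HasDerivAt (fun u : ℝ => -u ^ 2 / 2) (-u) u := by
    have := ((hasDerivAt_pow 2 u).neg).div_const 2
    refine this.congr_deriv ?_
    simp; ring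
  have := (h1.exp).const_mul ((√(2 * π))⁻¹)
  refine this.congr_deriv ?_
  ring

lemma g_int : Integrable g := by
  have h : gaussianPDFReal 0 1 = g := funext g_eq
  exact h ▸ integrable_gaussianPDFReal 0 1

lemma g_integral : ∫ u, g u = 1 := by
  have := integral_gaussianPDFReal_eq_one 0 (v := 1) one_ne_zero
  simpa only [g_eq] using this

lemma integral_gauss (X : ℝ → ℝ) : ∫ u, X u ∂(gaussianReal 0 1) = ∫ u, X u * g u := by
  rw [integral_gaussianReal_eq_integral_smul one_ne_zero]
  simp only [g_eq, smul_eq_mul, mul_comm]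

lemma integrable_gauss (X : ℝ → ℝ) :
    Integrable X (gaussianReal 0 1) ↔ Integrable (fun u => X u * g u) := by
  rw [gaussianReal_of_var_ne_zero _ one_ne_zero,
    integrable_withDensity_iff (measurable_gaussianPDF 0 1) (ae_of_all _ fun _ ↦ gaussianPDF_lt_top)]
  simp only [toReal_gaussianPDF, g_eq]

lemma mu_eq : mu = (volume : Measure (ℝ × ℝ)).withDensity
    (fun p => gaussianPDF 0 1 p.1 * gaussianPDF 0 1 p.2) := by
  unfold mu
  rw [gaussianReal_of_var_ne_zero _ one_ne_zero,
    prod_withDensity (measurable_gaussianPDF 0 1) (measurable_gaussianPDF 0 1)]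
  rfl

lemma integral_mu (X : ℝ × ℝ → ℝ) : ∫ p, X p ∂mu = ∫ p, X p * (g p.1 * g p.2) := by
  rw [mu_eq, integral_withDensity_eq_integral_toReal_smul]
  · simp only [ENNReal.toReal_mul, toReal_gaussianPDF, g_eq, smul_eq_mul, mul_comm]
  · have := measurable_gaussianPDF 0 1
    fun_prop
  · exact ae_of_all _ fun _ ↦ ENNReal.mul_lt_top gaussianPDF_lt_top gaussianPDF_lt_top

lemma int_one (n : ℕ) : Integrable (fun u : ℝ => (1 + |u|) ^ n) (gaussianReal 0 1) := by
  have h1 : MemLp (fun u : ℝ => 1 + |u|) n (gaussianReal 0 1) := by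
    have h := (memLp_id_gaussianReal' (μ := 0) (v := 1) (n : ENNReal) (by simp)).norm
    exact (memLp_const (1 : ℝ)).add h
  have := h1.integrable_norm_pow'
  refine this.congr (ae_of_all _ fun u => ?_)
  simp only [Real.norm_eq_abs]
  rw [abs_of_nonneg (by positivity)]

lemma poly_le (p : ℝ × ℝ) (n : ℕ) : (1 + ‖p‖) ^ n ≤ (1 + |p.1|) ^ n * (1 + |p.2|) ^ n := by
  rw [← mul_pow]
  apply pow_le_pow_left₀ (by positivity)
  have : ‖p‖ ≤ |p.1| + |p.2| := by
    rw [Prod.norm_def]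
    apply max_le <;> simp [Real.norm_eq_abs]
  nlinarith [abs_nonneg p.1, abs_nonneg p.2, mul_nonneg (abs_nonneg p.1) (abs_nonneg p.2)]

lemma int_poly (n : ℕ) : Integrable (fun p : ℝ × ℝ => (1 + ‖p‖) ^ n) mu := by
  have h := (int_one n).mul_prod (int_one n)
  refine h.mono (by fun_prop) (ae_of_all _ fun p => ?_)
  rw [Real.norm_of_nonneg (by positivity), Real.norm_of_nonneg (by positivity)]
  exact poly_le p n

lemma int_of_bound {X : ℝ × ℝ → ℝ} (hX : Continuous X) {C : ℝ} {n : ℕ}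
    (hb : ∀ p, |X p| ≤ C * (1 + ‖p‖) ^ n) : Integrable X mu :=
  ((int_poly n).const_mul C).mono' hX.aestronglyMeasurable (ae_of_all _ hb)

lemma mu_even (X : ℝ × ℝ → ℝ) : ∫ p, X (-p) ∂mu = ∫ p, X p ∂mu := by
  rw [integral_mu, integral_mu, ← integral_neg_eq_self]
  simp [g]

lemma mu_odd {X : ℝ × ℝ → ℝ} (h : ∀ p, X (-p) = -X p) : ∫ p, X p ∂mu = 0 := by
  have h1 := mu_even X
  simp only [h, integral_neg] at h1
  linarith

/-- Stein lemma in the first variable. -/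
lemma stein {X X' : ℝ × ℝ → ℝ} (hX : Continuous X) (hX' : Continuous X') {C : ℝ} {n : ℕ}
    (hb : ∀ p, |X p| ≤ C * (1 + ‖p‖) ^ n) (hb' : ∀ p, |X' p| ≤ C * (1 + ‖p‖) ^ n)
    (hd : ∀ u v, HasDerivAt (fun s => X (s, v)) (X' (u, v)) u) :
    ∫ p, p.1 * X p ∂mu = ∫ p, X' p ∂mu := by
  have hC : 0 ≤ C := by
    have := (abs_nonneg _).trans (hb 0)
    simpa using this
  have hi1 : Integrable (fun p : ℝ × ℝ => p.1 * X p) mu := by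
    refine int_of_bound (C := C) (n := n + 1) (by fun_prop) fun p => ?_
    rw [abs_mul, pow_succ]
    have h1 : |p.1| ≤ ‖p‖ := norm_fst_le p
    have := hb p
    calc |p.1| * |X p| ≤ (1 + ‖p‖) * (C * (1 + ‖p‖) ^ n) := by
          gcongr
          linarith
      _ = _ := by ring
  have hi2 : Integrable X' mu := int_of_bound hX' hb'
  unfold mu at *
  rw [integral_prod_symm _ hi1, integral_prod_symm _ hi2]
  congr 1
  ext v
  have key : ∀ (Y : ℝ × ℝ → ℝ), Continuous Y → (∀ p, |Y p| ≤ C * (1 + ‖p‖) ^ n) →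
      ∀ k : ℕ, Integrable (fun u => (u ^ k * Y (u, v)) * g u) := by
    intro Y hY hbY k
    rw [← integrable_gauss (fun u => u ^ k * Y (u, v))]
    refine ((int_one (n + k)).const_mul (C * (1 + |v|) ^ n)).mono' (by fun_prop) (ae_of_all _ fun u => ?_)
    have h1 := hbY (u, v)
    have h2 := poly_le (u, v) n
    simp only [Real.norm_eq_abs, abs_mul, abs_pow] at *
    calc |u| ^ k * |Y (u, v)| ≤ (1 + |u|) ^ k * (C * ((1 + |u|) ^ n * (1 + |v|) ^ n)) := by
          gcongr
          · linarith
          · exact h1.trans (by gcongr)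
      _ = _ := by rw [pow_add]; ring
  rw [integral_gauss, integral_gauss]
  have := integral_mul_deriv_eq_deriv_mul_of_integrable (u := fun u => X (u, v))
    (u' := fun u => X' (u, v)) (v := g) (v' := fun u => -u * g u) (fun u _ => hd u v)
    (fun u _ => g_deriv u) ?_ ?_ ?_
  · have h3 : ∫ u, X (u, v) * (-u * g u) = - ∫ u, u * X (u, v) * g u := by
      rw [← integral_neg]; congr 1; ext u; ring
    rw [h3] at this
    simpa using this
  · refine (key X hX hb 1).neg.congr (ae_of_all _ fun u => ?_)
    simp; ring
  · refine (key X' hX' hb' 0).congr (ae_of_all _ fun u => ?_)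
    simp
  · refine (key X hX hb 0).congr (ae_of_all _ fun u => ?_)
    simp

lemma abs_fst_le (p : ℝ × ℝ) : |p.1| ≤ 1 + ‖p‖ := by
  have : |p.1| ≤ ‖p‖ := norm_fst_le p
  linarith

lemma abs_snd_le (p : ℝ × ℝ) : |p.2| ≤ 1 + ‖p‖ := by
  have : |p.2| ≤ ‖p‖ := norm_snd_le p
  linarith

section Big
variable {ι : Type} {r : ι → ℝ}

/-- `X i p` is continuous in `p` and `O(r^k)` with polynomial growth in `p`. -/
def Big (r : ι → ℝ) (k : ℕ) (X : ι → ℝ × ℝ → ℝ) : Prop :=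
  (∀ i, Continuous (X i)) ∧ ∃ (C : ℝ) (n : ℕ), 0 ≤ C ∧
    ∀ i p, |X i p| ≤ C * r i ^ k * (1 + ‖p‖) ^ n

lemma Big.integrable {k : ℕ} {X : ι → ℝ × ℝ → ℝ} (h : Big r k X) (i : ι) :
    Integrable (X i) mu := by
  obtain ⟨hc, C, n, hC, hb⟩ := h
  exact int_of_bound (hc i) (hb i)

lemma Big.integral {k : ℕ} {X : ι → ℝ × ℝ → ℝ} (h : Big r k X) :
    ∃ C, 0 ≤ C ∧ ∀ i, |∫ p, X i p ∂mu| ≤ C * r i ^ k := by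
  obtain ⟨hc, C, n, hC, hb⟩ := h
  refine ⟨C * ∫ p : ℝ × ℝ, (1 + ‖p‖) ^ n ∂mu,
    mul_nonneg hC (integral_nonneg fun p => by positivity), fun i => ?_⟩
  have := norm_integral_le_of_norm_le ((int_poly n).const_mul (C * r i ^ k)) (ae_of_all _ (fun p => (Real.norm_eq_abs (X i p)).trans_le (hb i p)))
  rw [integral_const_mul] at this
  rw [Real.norm_eq_abs] at this
  linarith

lemma Big.mono {k l : ℕ} {X : ι → ℝ × ℝ → ℝ} (hr : ∀ i, 0 < r i ∧ r i ≤ 1) (h : Big r k X)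
    (hkl : l ≤ k) : Big r l X := by
  obtain ⟨hc, C, n, hC, hb⟩ := h
  refine ⟨hc, C, n, hC, fun i p => (hb i p).trans ?_⟩
  have := pow_le_pow_of_le_one (hr i).1.le (hr i).2 hkl
  gcongr

lemma Big.mul {k l : ℕ} {X Y : ι → ℝ × ℝ → ℝ} (hr : ∀ i, 0 < r i ∧ r i ≤ 1) (hX : Big r k X)
    (hY : Big r l Y) : Big r (k + l) (fun i p => X i p * Y i p) := by
  obtain ⟨hc, C, n, hC, hb⟩ := hX
  obtain ⟨hc', C', n', hC', hb'⟩ := hY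
  refine ⟨fun i => (hc i).mul (hc' i), C * C', n + n', by positivity, fun i p => ?_⟩
  rw [abs_mul]
  have := (hr i).1
  calc _ ≤ (C * r i ^ k * (1 + ‖p‖) ^ n) * (C' * r i ^ l * (1 + ‖p‖) ^ n') :=
        mul_le_mul (hb i p) (hb' i p) (abs_nonneg _) (by positivity)
    _ = _ := by ring

lemma Big.add {k : ℕ} {X Y : ι → ℝ × ℝ → ℝ} (hr : ∀ i, 0 < r i ∧ r i ≤ 1) (hX : Big r k X)
    (hY : Big r k Y) : Big r k (fun i p => X i p + Y i p) := by
  obtain ⟨hc, C, n, hC, hb⟩ := hX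
  obtain ⟨hc', C', n', hC', hb'⟩ := hY
  refine ⟨fun i => (hc i).add (hc' i), C + C', max n n', by positivity, fun i p => ?_⟩
  have hri := (hr i).1
  have h1 : (1 : ℝ) ≤ 1 + ‖p‖ := by linarith [norm_nonneg p]
  calc _ ≤ |X i p| + |Y i p| := abs_add_le _ _
    _ ≤ (C * r i ^ k * (1 + ‖p‖) ^ n) + (C' * r i ^ k * (1 + ‖p‖) ^ n') :=
        add_le_add (hb i p) (hb' i p)
    _ ≤ (C * r i ^ k * (1 + ‖p‖) ^ (max n n')) + (C' * r i ^ k * (1 + ‖p‖) ^ (max n n')) := by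
        gcongr
        · exact le_max_left _ _
        · exact le_max_right _ _
    _ = _ := by ring

lemma Big.neg {k : ℕ} {X : ι → ℝ × ℝ → ℝ} (hX : Big r k X) : Big r k (fun i p => - X i p) := by
  obtain ⟨hc, C, n, hC, hb⟩ := hX
  exact ⟨fun i => (hc i).neg, C, n, hC, fun i p => by rw [abs_neg]; exact hb i p⟩

lemma Big.sub {k : ℕ} {X Y : ι → ℝ × ℝ → ℝ} (hr : ∀ i, 0 < r i ∧ r i ≤ 1) (hX : Big r k X)
    (hY : Big r k Y) : Big r k (fun i p => X i p - Y i p) := by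
  simpa [sub_eq_add_neg] using hX.add hr hY.neg

lemma Big.const (hr : ∀ i, 0 < r i ∧ r i ≤ 1) {k : ℕ} (a : ι → ℝ) (C : ℝ) (hC : ∀ i, |a i| ≤ C * r i ^ k) :
    Big r k (fun i _ => a i) := by
  refine ⟨fun i => continuous_const, |C|, 0, abs_nonneg _, fun i p => ?_⟩
  have := (hr i).1
  simp only [pow_zero, mul_one]
  refine (hC i).trans ?_
  gcongr
  exact le_abs_self C

lemma Big.rpow (hr : ∀ i, 0 < r i ∧ r i ≤ 1) (k : ℕ) : Big r k (fun i _ => r i ^ k) :=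
  Big.const hr _ 1 fun i => by rw [abs_of_nonneg (pow_nonneg (hr i).1.le _), one_mul]

lemma Big.poly {X : ℝ × ℝ → ℝ} (hX : Continuous X) (C : ℝ) (n : ℕ)
    (hb : ∀ p, |X p| ≤ C * (1 + ‖p‖) ^ n) : Big r 0 (fun _ p => X p) := by
  refine ⟨fun _ => hX, |C|, n, abs_nonneg _, fun i p => (hb p).trans ?_⟩
  rw [pow_zero, mul_one]
  gcongr
  exact le_abs_self C

lemma Big.fst : Big r 0 (fun _ p => p.1) :=
  Big.poly continuous_fst 1 1 fun p => by simpa using abs_fst_le p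

lemma Big.snd : Big r 0 (fun _ p => p.2) :=
  Big.poly continuous_snd 1 1 fun p => by simpa using abs_snd_le p

lemma Big.cst (a : ℝ) : Big r 0 (fun _ _ => a) :=
  Big.poly continuous_const |a| 0 fun p => by simp

lemma Big.of_le {k : ℕ} {X Y : ι → ℝ × ℝ → ℝ} (hX : ∀ i, Continuous (X i)) (hY : Big r k Y)
    (h : ∀ i p, |X i p| ≤ |Y i p|) : Big r k X := by
  obtain ⟨_, C, n, hC, hb⟩ := hY
  exact ⟨hX, C, n, hC, fun i p => (h i p).trans (hb i p)⟩

end Big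


/-! ### Partial derivatives and Taylor expansion -/

/-- partial derivative in the first variable -/
noncomputable def dx (F : ℝ × ℝ → ℝ) (q : ℝ × ℝ) : ℝ := fderiv ℝ F q (1, 0)
/-- partial derivative in the second variable -/
noncomputable def dy (F : ℝ × ℝ → ℝ) (q : ℝ × ℝ) : ℝ := fderiv ℝ F q (0, 1)

/-- smooth -/
def Sm (F : ℝ × ℝ → ℝ) : Prop := ContDiff ℝ (⊤ : ℕ∞) F

lemma Sm.fderiv {F : ℝ × ℝ → ℝ} (h : Sm F) : ContDiff ℝ (⊤ : ℕ∞) (fderiv ℝ F) :=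
  ContDiff.fderiv_right h (by norm_cast)

lemma Sm.dx {F : ℝ × ℝ → ℝ} (h : Sm F) : Sm (dx F) := h.fderiv.clm_apply contDiff_const
lemma Sm.dy {F : ℝ × ℝ → ℝ} (h : Sm F) : Sm (dy F) := h.fderiv.clm_apply contDiff_const

lemma Sm.diff {F : ℝ × ℝ → ℝ} (h : Sm F) : Differentiable ℝ F :=
  ContDiff.differentiable h (by norm_num)

lemma Sm.hasDerivAt_fst {F : ℝ × ℝ → ℝ} (h : Sm F) (u v : ℝ) :
    HasDerivAt (fun s => F (s, v)) (MBO.dx F (u, v)) u := by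
  have h1 : HasDerivAt (fun s : ℝ => (s, v)) ((1 : ℝ), (0 : ℝ)) u :=
    (hasDerivAt_id u).prodMk (hasDerivAt_const u v)
  exact (h.diff (u, v)).hasFDerivAt.comp_hasDerivAt u h1

lemma Sm.hasDerivAt_snd {F : ℝ × ℝ → ℝ} (h : Sm F) (u v : ℝ) :
    HasDerivAt (fun s => F (u, s)) (MBO.dy F (u, v)) v := by
  have h1 : HasDerivAt (fun s : ℝ => (u, s)) ((0 : ℝ), (1 : ℝ)) v :=
    (hasDerivAt_const v u).prodMk (hasDerivAt_id v)
  exact (h.diff (u, v)).hasFDerivAt.comp_hasDerivAt v h1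

lemma Sm.pdx {F : ℝ × ℝ → ℝ} (h : Sm F) :
    pdx (fun a b => F (a, b)) = fun a b => MBO.dx F (a, b) := by
  funext a b
  exact (h.hasDerivAt_fst a b).deriv

lemma Sm.pdy {F : ℝ × ℝ → ℝ} (h : Sm F) :
    pdy (fun a b => F (a, b)) = fun a b => MBO.dy F (a, b) := by
  funext a b
  exact (h.hasDerivAt_snd a b).deriv

lemma snd_apply {F : ℝ × ℝ → ℝ} (h : Sm F) (q v w : ℝ × ℝ) :
    _root_.fderiv ℝ (fun q => _root_.fderiv ℝ F q v) q w = _root_.fderiv ℝ (_root_.fderiv ℝ F) q w v := by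
  have h1 : DifferentiableAt ℝ (_root_.fderiv ℝ F) q := (h.fderiv.differentiable (by norm_num)) q
  rw [fderiv_clm_apply h1 (by fun_prop)]
  simp

lemma Sm.symm {F : ℝ × ℝ → ℝ} (h : Sm F) (q v w : ℝ × ℝ) :
    _root_.fderiv ℝ (_root_.fderiv ℝ F) q v w = _root_.fderiv ℝ (_root_.fderiv ℝ F) q w v := by
  have : IsSymmSndFDerivAt ℝ F q :=
    (ContDiff.contDiffAt h).isSymmSndFDerivAt (by simp; norm_cast)
  exact this v w

lemma Sm.dx_dy {F : ℝ × ℝ → ℝ} (h : Sm F) : MBO.dx (MBO.dy F) = MBO.dy (MBO.dx F) := by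
  funext q
  unfold MBO.dx MBO.dy
  rw [snd_apply h, snd_apply h, h.symm]

lemma dx_congr {F G : ℝ × ℝ → ℝ} {q : ℝ × ℝ} (h : F =ᶠ[nhds q] G) : dx F =ᶠ[nhds q] dx G := by
  filter_upwards [h.fderiv (𝕜 := ℝ)] with x hx
  simp [dx, hx]

lemma dy_congr {F G : ℝ × ℝ → ℝ} {q : ℝ × ℝ} (h : F =ᶠ[nhds q] G) : dy F =ᶠ[nhds q] dy G := by
  filter_upwards [h.fderiv (𝕜 := ℝ)] with x hx
  simp [dy, hx]

lemma cs_dx {F : ℝ × ℝ → ℝ} (h : HasCompactSupport F) : HasCompactSupport (dx F) :=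
  (h.fderiv (𝕜 := ℝ)).comp_left (g := fun L : (ℝ × ℝ) →L[ℝ] ℝ => L (1, 0)) rfl

/-- Taylor homogeneous parts (without factorials). -/
noncomputable def TD (F : ℝ × ℝ → ℝ) (k : ℕ) (p : ℝ × ℝ) : ℝ :=
  iteratedFDeriv ℝ k F 0 (fun _ => p)

lemma TD_cont (F : ℝ × ℝ → ℝ) (k : ℕ) : Continuous (TD F k) := by
  unfold TD
  fun_prop

lemma TD_smul (F : ℝ × ℝ → ℝ) (k : ℕ) (c : ℝ) (p : ℝ × ℝ) : TD F k (c • p) = c ^ k * TD F k p := by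
  unfold TD
  rw [(iteratedFDeriv ℝ k F 0).map_smul_univ (fun _ => c) (fun _ => p)]
  simp

lemma TD_neg (F : ℝ × ℝ → ℝ) (k : ℕ) (p : ℝ × ℝ) : TD F k (-p) = (-1) ^ k * TD F k p := by
  rw [← TD_smul]; simp

lemma TD_bound (F : ℝ × ℝ → ℝ) (k : ℕ) (p : ℝ × ℝ) :
    |TD F k p| ≤ ‖iteratedFDeriv ℝ k F 0‖ * (1 + ‖p‖) ^ k := by
  have := (iteratedFDeriv ℝ k F 0).le_opNorm (fun _ => p)
  simp only [Finset.prod_const, Finset.card_univ, Fintype.card_fin, Real.norm_eq_abs] at this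
  refine this.trans ?_
  gcongr
  linarith

lemma TD_big {ι : Type} {r : ι → ℝ} (F : ℝ × ℝ → ℝ) (k : ℕ) : Big r 0 (fun _ p => TD F k p) :=
  Big.poly (TD_cont F k) _ k (TD_bound F k)

lemma TD_zero (F : ℝ × ℝ → ℝ) (p : ℝ × ℝ) : TD F 0 p = F 0 := by simp [TD]

lemma TD_one (F : ℝ × ℝ → ℝ) (p : ℝ × ℝ) : TD F 1 p = p.1 * dx F 0 + p.2 * dy F 0 := by
  have : p = p.1 • ((1 : ℝ), (0 : ℝ)) + p.2 • ((0 : ℝ), (1 : ℝ)) := by ext <;> simp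
  unfold TD dx dy
  rw [iteratedFDeriv_one_apply]
  conv_lhs => rw [this]
  rw [map_add, map_smul, map_smul]
  rfl

lemma TD_two {F : ℝ × ℝ → ℝ} (h : Sm F) (p : ℝ × ℝ) :
    TD F 2 p = p.1 ^ 2 * dx (dx F) 0 + 2 * p.1 * p.2 * dx (dy F) 0 + p.2 ^ 2 * dy (dy F) 0 := by
  have : p = p.1 • ((1 : ℝ), (0 : ℝ)) + p.2 • ((0 : ℝ), (1 : ℝ)) := by ext <;> simp
  have e1 : dx (dx F) 0 = fderiv ℝ (fderiv ℝ F) 0 (1, 0) (1, 0) := snd_apply h _ _ _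
  have e2 : dx (dy F) 0 = fderiv ℝ (fderiv ℝ F) 0 (1, 0) (0, 1) := snd_apply h _ _ _
  have e3 : dy (dy F) 0 = fderiv ℝ (fderiv ℝ F) 0 (0, 1) (0, 1) := snd_apply h _ _ _
  have e4 := h.symm 0 (0, 1) (1, 0)
  unfold TD
  rw [iteratedFDeriv_two_apply, e1, e2, e3]
  conv_lhs => rw [this]
  simp only [map_add, map_smul, add_apply, smul_apply,
    smul_eq_mul, e4]
  ring

lemma taylor {F : ℝ × ℝ → ℝ} (h : Sm F) (hc : HasCompactSupport F) (n : ℕ) :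
    ∃ C, 0 ≤ C ∧ ∀ (r : ℝ) (p : ℝ × ℝ), 0 ≤ r →
      |F (r • p) - ∑ k ∈ Finset.range (n + 1), (k.factorial : ℝ)⁻¹ * (r ^ k * TD F k p)|
        ≤ C * r ^ (n + 1) * (1 + ‖p‖) ^ (n + 1) := by
  have hcont : Continuous (iteratedFDeriv ℝ (n + 1) F) :=
    ContDiff.continuous_iteratedFDeriv (by exact_mod_cast le_top) h
  obtain ⟨C, hC⟩ := (hc.iteratedFDeriv (𝕜 := ℝ) (n + 1)).exists_bound_of_continuous hcont
  have hC0 : 0 ≤ C := (norm_nonneg _).trans (hC 0)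
  refine ⟨C, hC0, fun r p hr => ?_⟩
  have ht := map_add_eq_sum_add_integral_iteratedFDeriv (f := F) (x := 0) (y := r • p) (n := n)
    (fun t _ => (ContDiff.contDiffAt h).of_le (by exact_mod_cast le_top))
  have e : ∀ k, iteratedFDeriv ℝ k F 0 (fun _ => r • p) = r ^ k * TD F k p := fun k => TD_smul F k r p
  simp only [zero_add, e, smul_eq_mul] at ht
  rw [ht, add_sub_cancel_left, abs_mul]
  have hb : ‖∫ t in (0 : ℝ)..1, (1 - t) ^ n * iteratedFDeriv ℝ (n + 1) F (t • r • p) (fun _ => r • p)‖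
      ≤ (C * r ^ (n + 1) * ‖p‖ ^ (n + 1)) * |1 - 0| := by
    apply intervalIntegral.norm_integral_le_of_norm_le_const
    intro t ht
    rw [Set.uIoc_of_le zero_le_one] at ht
    rw [norm_mul]
    have h1 : ‖(1 - t) ^ n‖ ≤ 1 := by
      rw [norm_pow, Real.norm_eq_abs]
      apply pow_le_one₀ (abs_nonneg _)
      rw [abs_le]; constructor <;> linarith [ht.1, ht.2]
    have h2 := (iteratedFDeriv ℝ (n + 1) F (t • r • p)).le_opNorm (fun _ => r • p)
    simp only [Finset.prod_const, Finset.card_univ, Fintype.card_fin, norm_smul,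
      Real.norm_eq_abs, abs_of_nonneg hr, mul_pow] at h2
    have h3 := hC (t • r • p)
    calc _ ≤ 1 * (C * (r ^ (n + 1) * ‖p‖ ^ (n + 1))) := by
          apply mul_le_mul h1 _ (norm_nonneg _) zero_le_one
          refine h2.trans ?_
          gcongr
      _ = _ := by ring
  have h4 : |((n.factorial : ℝ))⁻¹| ≤ 1 := by
    rw [abs_of_nonneg (by positivity)]
    apply inv_le_one_of_one_le₀
    exact_mod_cast Nat.succ_le_of_lt (Nat.factorial_pos n)
  rw [Real.norm_eq_abs] at hb
  calc _ ≤ 1 * ((C * r ^ (n + 1) * ‖p‖ ^ (n + 1)) * |1 - 0|) :=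
        mul_le_mul h4 hb (abs_nonneg _) zero_le_one
    _ ≤ _ := by
        simp only [sub_zero, abs_one, mul_one, one_mul]
        gcongr
        linarith

/-! ### The one dimensional profile functions -/

/-- `exp (-a²/2)` -/
noncomputable def ph (a : ℝ) : ℝ := exp (-a ^ 2 / 2)
/-- `∫₀ᵃ exp (-v²/2) dv` -/
noncomputable def ps (a : ℝ) : ℝ := ∫ v in (0 : ℝ)..a, ph v

lemma ph_cont : Continuous ph := by unfold ph; fun_prop

lemma ph_pos (a : ℝ) : 0 < ph a := exp_pos _
lemma ph_le_one (a : ℝ) : ph a ≤ 1 := by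
  unfold ph; rw [exp_le_one_iff]; nlinarith [sq_nonneg a]

lemma ph_deriv (u : ℝ) : HasDerivAt ph (-u * ph u) u := by
  unfold ph
  have h1 : HasDerivAt (fun u : ℝ => -u ^ 2 / 2) (-u) u := by
    have := ((hasDerivAt_pow 2 u).neg).div_const 2
    refine this.congr_deriv ?_
    simp; ring
  refine (h1.exp).congr_deriv ?_
  ring

lemma ps_deriv (u : ℝ) : HasDerivAt ps (ph u) u :=
  intervalIntegral.integral_hasDerivAt_right (ph_cont.intervalIntegrable _ _)
    (ph_cont.stronglyMeasurableAtFilter _ _) ph_cont.continuousAt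

lemma ps_cont : Continuous ps :=
  continuous_iff_continuousAt.2 fun u => (ps_deriv u).continuousAt

lemma ps_zero : ps 0 = 0 := by simp [ps]

lemma ps_lip (a b : ℝ) : |ps a - ps b| ≤ |a - b| := by
  have := Convex.norm_image_sub_le_of_norm_hasDerivWithin_le (f := ps) (f' := ph) (s := Set.univ)
    (C := 1) (x := b) (y := a) (fun x _ => (ps_deriv x).hasDerivWithinAt)
    (fun x _ => by rw [Real.norm_eq_abs, abs_of_pos (ph_pos x)]; exact ph_le_one x) convex_univ
    trivial trivial
  simpa using this

lemma ps_abs (a : ℝ) : |ps a| ≤ |a| := by simpa [ps_zero] using ps_lip a 0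

lemma ph_int : Integrable ph := by
  have := integrable_exp_neg_mul_sq (b := 1 / 2) (by norm_num)
  refine this.congr (ae_of_all _ fun x => ?_)
  simp only [ph]; congr 1; ring

lemma ps_bdd : ∃ M, 0 ≤ M ∧ ∀ a, |ps a| ≤ M := by
  refine ⟨∫ v, ph v, integral_nonneg fun v => (ph_pos v).le, fun a => ?_⟩
  have h := intervalIntegral.norm_integral_le_integral_norm_uIoc (f := ph) (a := 0) (b := a)
    (μ := volume)
  refine h.trans ?_
  simp only [Real.norm_eq_abs, abs_of_pos (ph_pos _)]
  exact setIntegral_le_integral ph_int (ae_of_all _ fun v => (ph_pos v).le)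

lemma ph_sub_one (a : ℝ) : |ph a - 1| ≤ a ^ 2 := by
  have h1 := ph_le_one a
  have h2 : -a ^ 2 / 2 + 1 ≤ ph a := add_one_le_exp _
  rw [abs_le]; constructor <;> nlinarith [sq_nonneg a]

lemma ph_two (a : ℝ) : |ph a - 1 + a ^ 2 / 2| ≤ a ^ 4 := by
  have h2 : -a ^ 2 / 2 + 1 ≤ ph a := add_one_le_exp _
  have h3 : ph a ≤ (1 + a ^ 2 / 2)⁻¹ := by
    have : a ^ 2 / 2 + 1 ≤ exp (a ^ 2 / 2) := add_one_le_exp _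
    have e : ph a = (exp (a ^ 2 / 2))⁻¹ := by rw [← exp_neg]; unfold ph; congr 1; ring
    rw [e]
    apply inv_anti₀ (by positivity)
    linarith
  have h4 : (1 + a ^ 2 / 2)⁻¹ ≤ 1 - a ^ 2 / 2 + a ^ 4 := by
    rw [inv_le_iff_one_le_mul₀ (by positivity)]
    have := sq_nonneg a
    have h5 : 0 ≤ a ^ 4 := by positivity
    have h6 : 0 ≤ a ^ 6 := by positivity
    nlinarith
  rw [abs_le]; constructor
  · nlinarith [sq_nonneg (a ^ 2)]
  · linarith

lemma mul_ph_sub (a : ℝ) : |a * ph a - a| ≤ |a| ^ 3 := by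
  have : a * ph a - a = a * (ph a - 1) := by ring
  rw [this, abs_mul, pow_succ', sq_abs]
  exact mul_le_mul_of_nonneg_left (ph_sub_one a) (abs_nonneg a)

lemma mul_ph_le (a : ℝ) : |a * ph a| ≤ 1 := by
  have e : ph a = (exp (a ^ 2 / 2))⁻¹ := by rw [← exp_neg]; unfold ph; congr 1; ring
  have : a ^ 2 / 2 + 1 ≤ exp (a ^ 2 / 2) := add_one_le_exp _
  rw [e, abs_mul, abs_inv, abs_of_pos (exp_pos _), ← div_eq_mul_inv, div_le_one (exp_pos _)]
  have := sq_abs a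
  nlinarith [sq_nonneg (|a| - 1)]

lemma ps_sub (a : ℝ) : |ps a - a| ≤ |a| ^ 3 := by
  have := Convex.norm_image_sub_le_of_norm_hasDerivWithin_le (f := fun x => ps x - x)
    (f' := fun x => ph x - 1) (s := Set.uIcc 0 a)
    (C := |a| ^ 2) (x := 0) (y := a)
    (fun x _ => ((ps_deriv x).sub (hasDerivAt_id x)).hasDerivWithinAt)
    (fun x hx => by
      rw [Real.norm_eq_abs]
      refine (ph_sub_one x).trans ?_
      rw [← sq_abs]
      have : |x| ≤ |a| := by
        have := Set.abs_sub_left_of_mem_uIcc hx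
        simpa using this
      gcongr) (convex_uIcc 0 a)
    Set.left_mem_uIcc Set.right_mem_uIcc
  simp only [ps_zero, sub_zero, Real.norm_eq_abs] at this
  rw [pow_succ]
  exact this

lemma ps_mono : Monotone ps :=
  monotone_of_deriv_nonneg (fun x => (ps_deriv x).differentiableAt)
    fun x => by rw [(ps_deriv x).deriv]; exact (ph_pos x).le

lemma ps_neg (a : ℝ) : ps (-a) = - ps a := by
  unfold ps
  have h := intervalIntegral.integral_comp_neg (f := ph) (a := 0) (b := a)
  have e : ∀ x, ph (-x) = ph x := fun x => by simp [ph]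
  simp only [e, neg_zero] at h
  rw [h, intervalIntegral.integral_symm]

lemma ps_lower_aux {a : ℝ} (h0 : 0 ≤ a) (h1 : a ≤ 1) : a / 2 ≤ ps a := by
  have h : ∀ v ∈ Set.Icc (0 : ℝ) a, (1 / 2 : ℝ) ≤ ph v := by
    intro v hv
    have h2 : -v ^ 2 / 2 + 1 ≤ ph v := add_one_le_exp _
    have : v ^ 2 ≤ 1 := by nlinarith [hv.1, hv.2]
    linarith
  have := intervalIntegral.integral_mono_on (f := fun _ => (1 / 2 : ℝ)) (μ := volume) h0
    (continuous_const.intervalIntegrable _ _) (ph_cont.intervalIntegrable _ _) h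
  unfold ps
  simp at this
  linarith

lemma ps_lower (a : ℝ) : min |a| 1 / 2 ≤ |ps a| := by
  have key : ∀ b : ℝ, 0 ≤ b → min b 1 / 2 ≤ ps b := by
    intro b hb
    rcases le_total b 1 with h | h
    · rw [min_eq_left h]; exact ps_lower_aux hb h
    · rw [min_eq_right h]; exact (ps_lower_aux zero_le_one le_rfl).trans (ps_mono h)
  rcases le_total 0 a with h | h
  · rw [abs_of_nonneg h]; exact (key a h).trans (le_abs_self _)
  · rw [abs_of_nonpos h]
    have := key (-a) (by linarith)
    rw [ps_neg] at this
    exact this.trans (neg_le_abs _)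


/-! ### Asymptotic expansions -/

lemma Big.congr {ι : Type} {r : ι → ℝ} {k : ℕ} {X Y : ι → ℝ × ℝ → ℝ} (h : Big r k X)
    (e : ∀ i p, X i p = Y i p) : Big r k Y := by
  have : X = Y := by funext i p; exact e i p
  exact this ▸ h

lemma Big.expand {ι : Type} {r : ι → ℝ} {k : ℕ} {X Y O : ι → ℝ × ℝ → ℝ}
    (h : Big r k (fun i p => X i p - Y i p - O i p)) (hY : Big r 0 Y) (hO : Big r 0 O)
    (hodd : ∀ i p, O i (-p) = -O i p) :
    ∃ C, 0 ≤ C ∧ ∀ i, |∫ p, X i p ∂mu - ∫ p, Y i p ∂mu| ≤ C * r i ^ k := by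
  obtain ⟨C, hC, hb⟩ := h.integral
  refine ⟨C, hC, fun i => ?_⟩
  have h1 : ∫ p, X i p ∂mu = ∫ p, ((X i p - Y i p - O i p) + Y i p) + O i p ∂mu := by
    congr 1; ext p; ring
  have h2 := integral_add ((h.integrable i).add (hY.integrable i)) (hO.integrable i)
  have h3 := integral_add (h.integrable i) (hY.integrable i)
  simp only [Pi.add_apply] at h2 h3
  rw [h1, h2, h3, mu_odd (hodd i), add_zero, add_sub_cancel_right]
  exact hb i

section Exp
variable {ι : Type} {r m0 : ι → ℝ} {K : ℝ} {F : ℝ × ℝ → ℝ}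

/-- The scaled profile. -/
noncomputable def WW (F : ℝ × ℝ → ℝ) (r m0 : ℝ) (p : ℝ × ℝ) : ℝ := F (r • p) / r - m0

lemma WW_cont (hF : Sm F) (r m0 : ℝ) : Continuous (WW F r m0) := by
  have := ContDiff.continuous hF
  unfold WW
  fun_prop

lemma taylor_big (hr : ∀ i, 0 < r i ∧ r i ≤ 1) (hF : Sm F) (hc : HasCompactSupport F) (n : ℕ) :
    Big r (n + 1) (fun i p => F (r i • p)
      - ∑ k ∈ Finset.range (n + 1), (k.factorial : ℝ)⁻¹ * (r i ^ k * TD F k p)) := by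
  obtain ⟨C, hC, hb⟩ := taylor hF hc n
  refine ⟨fun i => ?_, C, n + 1, hC, fun i p => hb (r i) p (hr i).1.le⟩
  have := ContDiff.continuous hF
  have h2 := fun k => TD_cont F k
  fun_prop

lemma W_exp (hr : ∀ i, 0 < r i ∧ r i ≤ 1) (hF : Sm F) (hc : HasCompactSupport F)
    (h0 : F 0 = 0) (hx : dx F 0 = 0) (hy : dy F 0 = 0) :
    Big r 3 (fun i p => WW F (r i) (m0 i) p
      - (r i * (TD F 2 p / 2) - m0 i + r i ^ 2 * (TD F 3 p / 6))) := by
  obtain ⟨C, hC, hb⟩ := taylor hF hc 3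
  refine ⟨fun i => ?_, C, 4, hC, fun i p => ?_⟩
  · have := WW_cont hF (r i) (m0 i)
    have h2 := fun k => TD_cont F k
    fun_prop
  · have h := hb (r i) p (hr i).1.le
    have hri := (hr i).1
    simp only [Finset.sum_range_succ, Finset.range_zero, Finset.sum_empty, TD_zero, TD_one, h0, hx, hy,
      mul_zero, add_zero, zero_add] at h
    have e : WW F (r i) (m0 i) p - (r i * (TD F 2 p / 2) - m0 i + r i ^ 2 * (TD F 3 p / 6))
        = (F (r i • p) - (((Nat.factorial 2 : ℕ) : ℝ)⁻¹ * (r i ^ 2 * TD F 2 p)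
          + ((Nat.factorial 3 : ℕ) : ℝ)⁻¹ * (r i ^ 3 * TD F 3 p))) / r i := by
      unfold WW
      simp only [Nat.factorial]
      push_cast
      field_simp
      ring
    beta_reduce
    rw [e, abs_div, abs_of_pos hri, div_le_iff₀ hri]
    refine h.trans (le_of_eq ?_)
    ring

lemma TD_div (k : ℕ) (c : ℝ) : Big r 0 (fun _ p => TD F k p / c) :=
  Big.poly ((TD_cont F k).div_const c) (‖iteratedFDeriv ℝ k F 0‖ / |c|) k fun p => by
    rw [abs_div, div_mul_eq_mul_div]
    gcongr
    exact TD_bound F k p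

lemma m0_big (hr : ∀ i, 0 < r i ∧ r i ≤ 1) (hm : ∀ i, |m0 i| ≤ K * r i) :
    Big r 1 (fun i _ => m0 i) := Big.const hr _ K (by simpa using hm)

lemma Big.r1 (hr : ∀ i, 0 < r i ∧ r i ≤ 1) : Big r 1 (fun i _ => r i) :=
  (Big.rpow hr 1).congr (by simp)

/-- leading part of the scaled profile -/
lemma lead_big (hr : ∀ i, 0 < r i ∧ r i ≤ 1) (hm : ∀ i, |m0 i| ≤ K * r i) :
    Big r 1 (fun i p => r i * (TD F 2 p / 2) - m0 i) :=
  ((Big.r1 hr).mul hr (TD_div 2 2)).sub hr (m0_big hr hm)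

lemma c_big (hr : ∀ i, 0 < r i ∧ r i ≤ 1) (n k : ℕ) (c : ℝ) :
    Big r n (fun i p => r i ^ n * (TD F k p / c)) := (Big.rpow hr n).mul hr (TD_div k c)

lemma W_two (hr : ∀ i, 0 < r i ∧ r i ≤ 1) (hF : Sm F) (hc : HasCompactSupport F)
    (h0 : F 0 = 0) (hx : dx F 0 = 0) (hy : dy F 0 = 0) :
    Big r 2 (fun i p => WW F (r i) (m0 i) p - (r i * (TD F 2 p / 2) - m0 i)) :=
  (((W_exp (m0 := m0) hr hF hc h0 hx hy).mono hr (by norm_num : 2 ≤ 3)).add hr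
    (c_big hr 2 3 6)).congr fun i p => by ring

lemma W_one (hr : ∀ i, 0 < r i ∧ r i ≤ 1) (hm : ∀ i, |m0 i| ≤ K * r i) (hF : Sm F)
    (hc : HasCompactSupport F) (h0 : F 0 = 0) (hx : dx F 0 = 0) (hy : dy F 0 = 0) :
    Big r 1 (fun i p => WW F (r i) (m0 i) p) :=
  (((W_two (m0 := m0) hr hF hc h0 hx hy).mono hr (by norm_num : 1 ≤ 2)).add hr
    (lead_big hr hm)).congr fun i p => by ring

/-- Bundle of all basic order facts. -/
structure Pack (ι : Type) (r m0 : ι → ℝ) (F : ℝ × ℝ → ℝ) : Prop where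
  hr : ∀ i, 0 < r i ∧ r i ≤ 1
  M : Big r 1 (fun i p => r i * (TD F 2 p / 2) - m0 i)
  W1 : Big r 1 (fun i p => WW F (r i) (m0 i) p)
  W2 : Big r 2 (fun i p => WW F (r i) (m0 i) p - (r i * (TD F 2 p / 2) - m0 i))
  W3 : Big r 3 (fun i p => WW F (r i) (m0 i) p
      - (r i * (TD F 2 p / 2) - m0 i + r i ^ 2 * (TD F 3 p / 6)))
  P1 : Big r 2 (fun i p => ph (WW F (r i) (m0 i) p) - 1)
  P2 : Big r 4 (fun i p => ph (WW F (r i) (m0 i) p) - 1 + WW F (r i) (m0 i) p ^ 2 / 2)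
  Q3 : Big r 3 (fun i p => WW F (r i) (m0 i) p * ph (WW F (r i) (m0 i) p) - WW F (r i) (m0 i) p)
  S3 : Big r 3 (fun i p => ps (WW F (r i) (m0 i) p) - WW F (r i) (m0 i) p)
  P0 : Big r 0 (fun i p => ph (WW F (r i) (m0 i) p))
  B1 : Big r 1 (fun i p => dx F (r i • p))
  B2 : Big r 2 (fun i p => dx F (r i • p) - r i * TD (dx F) 1 p)
  B3 : Big r 3 (fun i p => dx F (r i • p) - r i * TD (dx F) 1 p - r i ^ 2 * (TD (dx F) 2 p / 2))
  D0 : Big r 1 (fun i p => dx (dx F) (r i • p) - dx (dx F) 0)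
  D1 : Big r 2 (fun i p => dx (dx F) (r i • p) - dx (dx F) 0 - r i * TD (dx (dx F)) 1 p)
  D3 : Big r 4 (fun i p => dx (dx F) (r i • p) - dx (dx F) 0 - r i * TD (dx (dx F)) 1 p
    - r i ^ 2 * (TD (dx (dx F)) 2 p / 2) - r i ^ 3 * (TD (dx (dx F)) 3 p / 6))

lemma mkPack (hr : ∀ i, 0 < r i ∧ r i ≤ 1) (hm : ∀ i, |m0 i| ≤ K * r i) (hF : Sm F)
    (hc : HasCompactSupport F) (h0 : F 0 = 0) (hx : dx F 0 = 0) (hy : dy F 0 = 0) :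
    Pack ι r m0 F := by
  have hW1 := W_one hr hm hF hc h0 hx hy
  have hWc := fun i => WW_cont hF (r i) (m0 i)
  have hphc := ph_cont
  have hpsc := ps_cont
  have B3 : Big r 3 (fun i p => dx F (r i • p) - r i * TD (dx F) 1 p
      - r i ^ 2 * (TD (dx F) 2 p / 2)) :=
    (taylor_big hr hF.dx (cs_dx hc) 2).congr fun i p => by
      simp only [Finset.sum_range_succ, Finset.range_zero, Finset.sum_empty, TD_zero, hx,
        Nat.factorial]
      push_cast
      ring
  have B2 : Big r 2 (fun i p => dx F (r i • p) - r i * TD (dx F) 1 p) :=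
    ((B3.mono hr (by norm_num : 2 ≤ 3)).add hr (c_big hr 2 2 2)).congr fun i p => by ring
  have B1 : Big r 1 (fun i p => dx F (r i • p)) :=
    ((B2.mono hr (by norm_num : 1 ≤ 2)).add hr ((Big.r1 hr).mul hr (TD_big (dx F) 1))).congr
      fun i p => by ring
  have D3 : Big r 4 (fun i p => dx (dx F) (r i • p) - dx (dx F) 0 - r i * TD (dx (dx F)) 1 p
    - r i ^ 2 * (TD (dx (dx F)) 2 p / 2) - r i ^ 3 * (TD (dx (dx F)) 3 p / 6)) :=
    (taylor_big hr hF.dx.dx (cs_dx (cs_dx hc)) 3).congr fun i p => by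
      simp only [Finset.sum_range_succ, Finset.range_zero, Finset.sum_empty, TD_zero,
        Nat.factorial]
      push_cast
      ring
  have D1 : Big r 2 (fun i p => dx (dx F) (r i • p) - dx (dx F) 0 - r i * TD (dx (dx F)) 1 p) :=
    (((D3.mono hr (by norm_num : 2 ≤ 4)).add hr (c_big hr 2 2 2)).add hr
      ((c_big hr 3 3 6).mono hr (by norm_num : 2 ≤ 3))).congr fun i p => by ring
  have D0 : Big r 1 (fun i p => dx (dx F) (r i • p) - dx (dx F) 0) :=
    ((D1.mono hr (by norm_num : 1 ≤ 2)).add hr ((Big.r1 hr).mul hr (TD_big (dx (dx F)) 1))).congr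
      fun i p => by ring
  refine ⟨hr, lead_big hr hm, hW1, W_two hr hF hc h0 hx hy, W_exp hr hF hc h0 hx hy, ?_, ?_, ?_, ?_,
    ?_, B1, B2, B3, D0, D1, D3⟩
  · refine Big.of_le (fun i => by have := hWc i; fun_prop) (hW1.mul hr hW1) fun i p => ?_
    rw [← pow_two, abs_of_nonneg (sq_nonneg (WW F (r i) (m0 i) p))]
    exact ph_sub_one _
  · refine Big.of_le (fun i => by have := hWc i; fun_prop)
      ((hW1.mul hr hW1).mul hr (hW1.mul hr hW1)) fun i p => ?_
    refine (ph_two _).trans ((le_of_eq ?_).trans (le_abs_self _))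
    ring
  · refine Big.of_le (fun i => by have := hWc i; fun_prop)
      ((hW1.mul hr hW1).mul hr hW1) fun i p => ?_
    refine (mul_ph_sub _).trans (le_of_eq ?_)
    rw [abs_mul, abs_mul]; ring
  · refine Big.of_le (fun i => by have := hWc i; fun_prop)
      ((hW1.mul hr hW1).mul hr hW1) fun i p => ?_
    refine (ps_sub _).trans (le_of_eq ?_)
    rw [abs_mul, abs_mul]; ring
  · refine Big.of_le (fun i => by have := hWc i; fun_prop) (Big.cst 1) fun i p => ?_
    rw [abs_of_pos (ph_pos _), abs_one]
    exact ph_le_one _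

namespace Pack

lemma e_one (P : Pack ι r m0 F) : ∃ C, 0 ≤ C ∧ ∀ i, |∫ p, ph (WW F (r i) (m0 i) p) ∂mu - 1| ≤ C * r i ^ 2 := by
  have := Big.expand (X := fun i p => ph (WW F (r i) (m0 i) p)) (Y := fun _ _ => 1)
    (O := fun _ _ => 0) (P.P1.congr fun i p => by ring) (Big.cst 1) (Big.cst 0) (by simp)
  simpa using this

lemma e_two (P : Pack ι r m0 F) : ∃ C, 0 ≤ C ∧ ∀ i,
    |∫ p, WW F (r i) (m0 i) p * ph (WW F (r i) (m0 i) p) ∂mu| ≤ C * r i ^ 1 :=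
  (P.W1.mul P.hr P.P0).integral

lemma M0 (P : Pack ι r m0 F) : Big r 0 (fun i p => r i * (TD F 2 p / 2) - m0 i) := P.M.mono P.hr (by norm_num)
lemma R (P : Pack ι r m0 F) (n : ℕ) : Big r 0 (fun i _ => r i ^ n) := (Big.rpow P.hr n).mono P.hr (by norm_num)
lemma R1 (P : Pack ι r m0 F) : Big r 0 (fun i _ => r i) := (Big.r1 P.hr).mono P.hr (by norm_num)

lemma e_three (P : Pack ι r m0 F) : ∃ C, 0 ≤ C ∧ ∀ i,
    |∫ p, WW F (r i) (m0 i) p * ph (WW F (r i) (m0 i) p) * dx F (r i • p) ∂mu| ≤ C * r i ^ 3 := by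
  have hr := P.hr
  have := Big.expand (k := 3)
    (X := fun i p => WW F (r i) (m0 i) p * ph (WW F (r i) (m0 i) p) * dx F (r i • p))
    (Y := fun _ _ => 0)
    (O := fun i p => (r i * (TD F 2 p / 2) - m0 i) * (r i * TD (dx F) 1 p))
    ((((((P.Q3.mul hr P.B1).mono hr (by norm_num : 3 ≤ 3 + 1)).add hr (P.W2.mul hr P.B1)).add hr
      (P.M.mul hr P.B2))).congr fun i p => by ring) (Big.cst 0)
      (P.M0.mul hr (P.R1.mul hr (TD_big _ 1)))
      (fun i p => by rw [TD_neg, TD_neg]; ring)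
  simpa using this

lemma e_four (P : Pack ι r m0 F) : ∃ C, 0 ≤ C ∧ ∀ i,
    |∫ p, ph (WW F (r i) (m0 i) p) * dx F (r i • p) ∂mu| ≤ C * r i ^ 2 := by
  have hr := P.hr
  have := Big.expand (k := 2)
    (X := fun i p => ph (WW F (r i) (m0 i) p) * dx F (r i • p))
    (Y := fun _ _ => 0)
    (O := fun i p => (r i * TD (dx F) 1 p))
    ((((P.P1.mul hr P.B1).mono hr (by norm_num : 2 ≤ 2 + 1)).add hr P.B2).congr
      fun i p => by ring) (Big.cst 0) (P.R1.mul hr (TD_big _ 1))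
      (fun i p => by rw [TD_neg]; ring)
  simpa using this

lemma e_five (P : Pack ι r m0 F) : ∃ C, 0 ≤ C ∧ ∀ i,
    |∫ p, ps (WW F (r i) (m0 i) p) ∂mu - ∫ p, (r i * (TD F 2 p / 2) - m0 i) ∂mu| ≤ C * r i ^ 3 := by
  have hr := P.hr
  exact Big.expand (k := 3)
    (X := fun i p => ps (WW F (r i) (m0 i) p))
    (Y := fun i p => r i * (TD F 2 p / 2) - m0 i)
    (O := fun i p => r i ^ 2 * (TD F 3 p / 6))
    ((P.S3.add hr P.W3).congr fun i p => by ring) P.M0 ((P.R 2).mul hr (TD_div 3 6))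
      (fun i p => by rw [TD_neg]; ring)

lemma e_six (P : Pack ι r m0 F) : ∃ C, 0 ≤ C ∧ ∀ i,
    |∫ p, ph (WW F (r i) (m0 i) p) * (dx (dx F) (r i • p) - dx (dx F) 0) ∂mu
      - ∫ p, r i ^ 2 * (TD (dx (dx F)) 2 p / 2) ∂mu| ≤ C * r i ^ 4 := by
  have hr := P.hr
  have h1 := P.P2.mul hr P.D0
  have h2 := ((P.W2.mul hr (P.W1.add hr P.M)).mul hr P.D0).mul hr (Big.cst (1 / 2))
  have h3 := ((P.M.mul hr P.M).mul hr P.D1).mul hr (Big.cst (1 / 2))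
  exact Big.expand (k := 4)
    (X := fun i p => ph (WW F (r i) (m0 i) p) * (dx (dx F) (r i • p) - dx (dx F) 0))
    (Y := fun i p => r i ^ 2 * (TD (dx (dx F)) 2 p / 2))
    (O := fun i p => r i * TD (dx (dx F)) 1 p + r i ^ 3 * (TD (dx (dx F)) 3 p / 6)
      - (1 / 2) * ((r i * (TD F 2 p / 2) - m0 i) * (r i * (TD F 2 p / 2) - m0 i)
        * (r i * TD (dx (dx F)) 1 p)))
    (((((h1.mono hr (by norm_num : 4 ≤ 4 + 1)).sub hr h2).sub hr h3).add hr P.D3).congr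
      fun i p => by ring) ((P.R 2).mul hr (TD_div 2 2))
    (((P.R1.mul hr (TD_big _ 1)).add hr ((P.R 3).mul hr (TD_div 3 6))).sub hr
      ((Big.cst (1 / 2)).mul hr ((P.M0.mul hr P.M0).mul hr (P.R1.mul hr (TD_big _ 1)))))
    (fun i p => by rw [TD_neg, TD_neg, TD_neg]; ring)

lemma e_seven (P : Pack ι r m0 F) : ∃ C, 0 ≤ C ∧ ∀ i,
    |∫ p, WW F (r i) (m0 i) p * ph (WW F (r i) (m0 i) p) * (dx F (r i • p) * dx F (r i • p)) ∂mu
      - ∫ p, r i ^ 2 * ((r i * (TD F 2 p / 2) - m0 i) * (TD (dx F) 1 p * TD (dx F) 1 p)) ∂mu|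
      ≤ C * r i ^ 5 := by
  have hr := P.hr
  have BB := P.B1.mul hr P.B1
  have l1 : Big r 1 (fun i p => r i * TD (dx F) 1 p) := (Big.r1 hr).mul hr (TD_big _ 1)
  have l2 : Big r 2 (fun i p => r i ^ 2 * (TD (dx F) 2 p / 2)) := c_big hr 2 2 2
  have c2 : Big r 2 (fun i p => r i ^ 2 * (TD F 3 p / 6)) := c_big hr 2 3 6
  have hsq := (P.B3.mul hr ((P.B1.add hr l1).add hr (l2.mono hr (by norm_num : 1 ≤ 2)))).add hr
    ((l2.mul hr l2).mono hr (by norm_num : 3 + 1 ≤ 2 + 2))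
  have h1 := P.Q3.mul hr BB
  have h2 := P.W3.mul hr BB
  have h3 := (P.M.add hr (c2.mono hr (by norm_num : 1 ≤ 2))).mul hr hsq
  have h4 := (c2.mul hr (l1.mul hr l2)).mul hr (Big.cst 2)
  have t1 : Big r 0 (fun _ p => TD (dx F) 1 p) := TD_big _ 1
  exact Big.expand (k := 5)
    (X := fun i p => WW F (r i) (m0 i) p * ph (WW F (r i) (m0 i) p)
      * (dx F (r i • p) * dx F (r i • p)))
    (Y := fun i p => r i ^ 2 * ((r i * (TD F 2 p / 2) - m0 i) * (TD (dx F) 1 p * TD (dx F) 1 p)))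
    (O := fun i p => r i ^ 2 * ((r i ^ 2 * (TD F 3 p / 6)) * (TD (dx F) 1 p * TD (dx F) 1 p))
      + 2 * ((r i * (TD F 2 p / 2) - m0 i) * (r i ^ 3 * (TD (dx F) 1 p * (TD (dx F) 2 p / 2)))))
    ((((h1.add hr h2).add hr h3).add hr h4).congr
      fun i p => by ring)
    ((P.R 2).mul hr (P.M0.mul hr (t1.mul hr t1)))
    (((P.R 2).mul hr (((P.R 2).mul hr (TD_div 3 6)).mul hr (t1.mul hr t1))).add hr
      ((Big.cst 2).mul hr (P.M0.mul hr ((P.R 3).mul hr (t1.mul hr (TD_div 2 2))))))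
    (fun i p => by rw [TD_neg, TD_neg, TD_neg, TD_neg]; ring)

end Pack
end Exp


/-! ### Moments and Stein identities -/

/-- one dimensional Gaussian moments -/
noncomputable def mom (k : ℕ) : ℝ := ∫ u, u ^ k ∂(gaussianReal 0 1)

lemma int_pow1 (k : ℕ) : Integrable (fun u : ℝ => u ^ k) (gaussianReal 0 1) := by
  refine (int_one k).mono' (by fun_prop) (ae_of_all _ fun u => ?_)
  rw [Real.norm_eq_abs, abs_pow]
  gcongr
  linarith

lemma int_mon (i j : ℕ) : Integrable (fun p : ℝ × ℝ => p.1 ^ i * p.2 ^ j) mu :=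
  (int_pow1 i).mul_prod (int_pow1 j)

lemma mom_mul (i j : ℕ) : ∫ p, p.1 ^ i * p.2 ^ j ∂mu = mom i * mom j :=
  integral_prod_mul (fun u : ℝ => u ^ i) (fun u : ℝ => u ^ j)

lemma mom_zero : mom 0 = 1 := by simp [mom]

lemma mom_fst (i : ℕ) : ∫ p, p.1 ^ i ∂mu = mom i := by
  have := mom_mul i 0
  simpa [mom_zero] using this

lemma mom_succ (k : ℕ) : mom (k + 2) = (k + 1) * mom k := by
  have hle : ∀ p : ℝ × ℝ, |p.1| ≤ 1 + ‖p‖ := abs_fst_le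
  have h1 : ∀ p : ℝ × ℝ, (1 : ℝ) ≤ 1 + ‖p‖ := fun p => by linarith [norm_nonneg p]
  have := stein (X := fun p => p.1 ^ (k + 1)) (X' := fun p => (k + 1) * p.1 ^ k) (C := k + 1)
    (n := k + 1) (by fun_prop) (by fun_prop) (fun p => by
      rw [abs_pow]
      calc |p.1| ^ (k + 1) ≤ 1 * (1 + ‖p‖) ^ (k + 1) := by
            rw [one_mul]; gcongr; exact hle p
        _ ≤ _ := by gcongr; linarith [(Nat.cast_nonneg k : (0 : ℝ) ≤ k)]) (fun p => by
      rw [abs_mul, abs_pow, abs_of_nonneg (by positivity)]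
      gcongr
      calc |p.1| ^ k ≤ (1 + ‖p‖) ^ k := by gcongr; exact hle p
        _ ≤ _ := pow_le_pow_right₀ (h1 p) (by omega)) (fun u v => by
      have := hasDerivAt_pow (k + 1) u
      refine this.congr_deriv ?_
      push_cast
      simp)
  rw [integral_const_mul, mom_fst] at this
  rw [← this, ← mom_fst]
  congr 1; ext p; ring

lemma mom_one : mom 1 = 0 := by
  rw [← mom_fst]
  exact mu_odd (fun p => by simp)

lemma mom_two : mom 2 = 1 := by rw [mom_succ 0, mom_zero]; simp
lemma mom_three : mom 3 = 0 := by rw [mom_succ 1, mom_one]; simp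
lemma mom_four : mom 4 = 3 := by rw [mom_succ 2, mom_two]; norm_num

lemma poly_two (a b c : ℝ) :
    ∫ p, (a * (p.1 ^ 2 * p.2 ^ 0) + b * (p.1 ^ 1 * p.2 ^ 1) + c * (p.1 ^ 0 * p.2 ^ 2)) ∂mu = a + c := by
  have i1 := (int_mon 2 0).const_mul a
  have i2 := (int_mon 1 1).const_mul b
  have i3 := (int_mon 0 2).const_mul c
  have i12 : Integrable (fun p : ℝ × ℝ => a * (p.1 ^ 2 * p.2 ^ 0) + b * (p.1 ^ 1 * p.2 ^ 1)) mu :=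
    i1.add i2
  rw [integral_add i12 i3, integral_add i1 i2,
    integral_const_mul, integral_const_mul, integral_const_mul, mom_mul, mom_mul, mom_mul,
    mom_zero, mom_one, mom_two]
  ring

lemma poly_four (a b c d e : ℝ) :
    ∫ p, (a * (p.1 ^ 4 * p.2 ^ 0) + b * (p.1 ^ 3 * p.2 ^ 1) + c * (p.1 ^ 2 * p.2 ^ 2)
      + d * (p.1 ^ 1 * p.2 ^ 3) + e * (p.1 ^ 0 * p.2 ^ 4)) ∂mu = 3 * a + c + 3 * e := by
  have i1 := (int_mon 4 0).const_mul a
  have i2 := (int_mon 3 1).const_mul b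
  have i3 := (int_mon 2 2).const_mul c
  have i4 := (int_mon 1 3).const_mul d
  have i5 := (int_mon 0 4).const_mul e
  have i12 : Integrable (fun p : ℝ × ℝ => a * (p.1 ^ 4 * p.2 ^ 0) + b * (p.1 ^ 3 * p.2 ^ 1)) mu :=
    i1.add i2
  have i123 : Integrable (fun p : ℝ × ℝ => a * (p.1 ^ 4 * p.2 ^ 0) + b * (p.1 ^ 3 * p.2 ^ 1)
      + c * (p.1 ^ 2 * p.2 ^ 2)) mu := i12.add i3
  have i1234 : Integrable (fun p : ℝ × ℝ => a * (p.1 ^ 4 * p.2 ^ 0) + b * (p.1 ^ 3 * p.2 ^ 1)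
      + c * (p.1 ^ 2 * p.2 ^ 2) + d * (p.1 ^ 1 * p.2 ^ 3)) mu := i123.add i4
  rw [integral_add i1234 i5, integral_add i123 i4, integral_add i12 i3, integral_add i1 i2,
    integral_const_mul, integral_const_mul, integral_const_mul, integral_const_mul,
    integral_const_mul, mom_mul, mom_mul, mom_mul, mom_mul, mom_mul,
    mom_zero, mom_one, mom_two, mom_three, mom_four]
  ring

section Stein
variable {F : ℝ × ℝ → ℝ}

lemma cs_bound (hF : Sm F) (hc : HasCompactSupport F) : ∃ C, 0 ≤ C ∧ ∀ q, |F q| ≤ C := by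
  obtain ⟨C, hC⟩ := hc.exists_bound_of_continuous (ContDiff.continuous hF)
  exact ⟨C, (norm_nonneg _).trans (hC 0), hC⟩

lemma scaled_deriv {G : ℝ × ℝ → ℝ} (hG : Sm G) (r u v : ℝ) :
    HasDerivAt (fun s => G (r • (s, v))) (r * dx G (r • (u, v))) u := by
  have h := (hG.hasDerivAt_fst (r * u) (r * v)).comp u ((hasDerivAt_id u).const_mul r)
  simp only [mul_one] at h
  refine (h.congr_deriv ?_)
  simp [mul_comm]

lemma WW_deriv (hF : Sm F) {r : ℝ} (hr : 0 < r) (m0 u v : ℝ) :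
    HasDerivAt (fun s => WW F r m0 (s, v)) (dx F (r • (u, v))) u := by
  have := ((scaled_deriv hF r u v).div_const r).sub_const m0
  refine this.congr_deriv ?_
  field_simp


lemma S_one (hF : Sm F) (hc : HasCompactSupport F) {r : ℝ} (hr : 0 < r) (m0 : ℝ)
    : ∫ p, p.1 * ps (WW F r m0 p) ∂mu = ∫ p, ph (WW F r m0 p) * dx F (r • p) ∂mu := by
  obtain ⟨M, hM, hb⟩ := ps_bdd
  obtain ⟨C, hC, hbC⟩ := cs_bound hF.dx (cs_dx hc)
  have c1 := WW_cont hF r m0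
  have c2 := ps_cont
  have c3 := ph_cont
  have c4 : Continuous (dx F) := ContDiff.continuous hF.dx
  refine stein (C := M + C) (n := 0) (by fun_prop) (by fun_prop) (fun p => ?_) (fun p => ?_)
    fun u v => ?_
  · simp only [pow_zero, mul_one]; linarith [hb (WW F r m0 p)]
  · simp only [pow_zero, mul_one]
    rw [abs_mul, abs_of_pos (ph_pos _)]
    nlinarith [ph_le_one (WW F r m0 p), hbC (r • p), ph_pos (WW F r m0 p), abs_nonneg (dx F (r • p))]
  · exact (ps_deriv _).comp u (WW_deriv hF hr m0 u v)

lemma S_two (hF : Sm F) (hc : HasCompactSupport F) {r : ℝ} (hr : 0 < r) (m0 : ℝ)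
    : ∫ p, p.1 * ph (WW F r m0 p) ∂mu
    = - ∫ p, WW F r m0 p * ph (WW F r m0 p) * dx F (r • p) ∂mu := by
  obtain ⟨C, hC, hbC⟩ := cs_bound hF.dx (cs_dx hc)
  have c1 := WW_cont hF r m0
  have c3 := ph_cont
  have c4 : Continuous (dx F) := ContDiff.continuous hF.dx
  rw [← integral_neg]
  refine stein (C := 1 + C) (n := 0) (by fun_prop) (by fun_prop) (fun p => ?_) (fun p => ?_)
    fun u v => ?_
  · simp only [pow_zero, mul_one]
    rw [abs_of_pos (ph_pos _)]
    linarith [ph_le_one (WW F r m0 p)]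
  · simp only [pow_zero, mul_one]
    rw [abs_neg, abs_mul]
    nlinarith [mul_ph_le (WW F r m0 p), hbC (r • p), abs_nonneg (dx F (r • p)),
      abs_nonneg (WW F r m0 p * ph (WW F r m0 p))]
  · refine ((ph_deriv _).comp u (WW_deriv hF hr m0 u v)).congr_deriv ?_
    ring

lemma S_three (hF : Sm F) (hc : HasCompactSupport F) {r : ℝ} (hr : 0 < r) (m0 : ℝ)
    : ∫ p, (p.1 ^ 2 - 1) * ps (WW F r m0 p) ∂mu
    = r * ∫ p, ph (WW F r m0 p) * dx (dx F) (r • p) ∂mu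
      - ∫ p, WW F r m0 p * ph (WW F r m0 p) * (dx F (r • p) * dx F (r • p)) ∂mu := by
  obtain ⟨M, hM, hb⟩ := ps_bdd
  obtain ⟨C, hC, hbC⟩ := cs_bound hF.dx (cs_dx hc)
  obtain ⟨D, hD, hbD⟩ := cs_bound hF.dx.dx (cs_dx (cs_dx hc))
  have c1 := WW_cont hF r m0
  have c2 := ps_cont
  have c3 := ph_cont
  have c4 : Continuous (dx F) := ContDiff.continuous hF.dx
  have c5 : Continuous (dx (dx F)) := ContDiff.continuous hF.dx.dx
  have b0 : ∀ p, |ps (WW F r m0 p)| ≤ M := fun p => hb _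
  have b1 : ∀ p, |ph (WW F r m0 p) * dx F (r • p)| ≤ C := fun p => by
    rw [abs_mul, abs_of_pos (ph_pos _)]
    nlinarith [ph_le_one (WW F r m0 p), hbC (r • p), ph_pos (WW F r m0 p), abs_nonneg (dx F (r • p))]
  have b2 : ∀ p, |ph (WW F r m0 p) * dx (dx F) (r • p)| ≤ D := fun p => by
    rw [abs_mul, abs_of_pos (ph_pos _)]
    nlinarith [ph_le_one (WW F r m0 p), hbD (r • p), ph_pos (WW F r m0 p),
      abs_nonneg (dx (dx F) (r • p))]
  have b3 : ∀ p, |WW F r m0 p * ph (WW F r m0 p) * (dx F (r • p) * dx F (r • p))| ≤ C * C := fun p => by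
    rw [abs_mul, abs_mul (dx F (r • p))]
    have h1 : |dx F (r • p)| * |dx F (r • p)| ≤ C * C :=
      mul_le_mul (hbC _) (hbC _) (abs_nonneg _) hC
    have h2 := mul_ph_le (WW F r m0 p)
    nlinarith [abs_nonneg (WW F r m0 p * ph (WW F r m0 p)),
      mul_nonneg (abs_nonneg (dx F (r • p))) (abs_nonneg (dx F (r • p)))]
  -- first integration by parts
  have e1 : ∫ p, p.1 * (p.1 * ps (WW F r m0 p)) ∂mu
      = ∫ p, (ps (WW F r m0 p) + p.1 * (ph (WW F r m0 p) * dx F (r • p))) ∂mu := by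
    refine stein (C := M + C) (n := 1) (by fun_prop) (by fun_prop) (fun p => ?_) (fun p => ?_)
      fun u v => ?_
    · rw [abs_mul, pow_one]
      have := abs_fst_le p
      calc _ ≤ (1 + ‖p‖) * M := mul_le_mul this (b0 p) (abs_nonneg _) (by positivity)
        _ ≤ _ := by nlinarith [norm_nonneg p]
    · rw [pow_one]
      have := abs_fst_le p
      refine (abs_add_le _ _).trans ?_
      rw [abs_mul p.1]
      have h1 : |p.1| * |ph (WW F r m0 p) * dx F (r • p)| ≤ (1 + ‖p‖) * C :=
        mul_le_mul this (b1 p) (abs_nonneg _) (by positivity)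
      nlinarith [norm_nonneg p, b0 p]
    · refine ((hasDerivAt_id u).mul ((ps_deriv _).comp u (WW_deriv hF hr m0 u v))).congr_deriv ?_
      simp
  have e2 : ∫ p, p.1 * (ph (WW F r m0 p) * dx F (r • p)) ∂mu
      = ∫ p, (r * (ph (WW F r m0 p) * dx (dx F) (r • p))
        - WW F r m0 p * ph (WW F r m0 p) * (dx F (r • p) * dx F (r • p))) ∂mu := by
    refine stein (C := C + (r * D + C * C)) (n := 0) (by fun_prop) (by fun_prop) (fun p => ?_)
      (fun p => ?_) fun u v => ?_
    · simp only [pow_zero, mul_one]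
      nlinarith [b1 p, mul_nonneg hr.le hD]
    · simp only [pow_zero, mul_one]
      refine (abs_sub _ _).trans ?_
      rw [abs_mul r, abs_of_pos hr]
      nlinarith [b2 p, b3 p]
    · refine (((ph_deriv _).comp u (WW_deriv hF hr m0 u v)).mul
        (scaled_deriv hF.dx r u v)).congr_deriv ?_
      simp only [Function.comp]
      ring
  have j0 : Integrable (fun p => ps (WW F r m0 p)) mu :=
    int_of_bound (C := M) (n := 0) (by fun_prop) (by simpa using b0)
  have jm : ∀ {Y : ℝ × ℝ → ℝ} {B : ℝ}, Integrable Y mu → Continuous Y → 0 ≤ B → (∀ p, |Y p| ≤ B) →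
      ∀ k : ℕ, Integrable (fun p => p.1 ^ k * Y p) mu := by
    intro Y B _ hY hB hYb k
    refine int_of_bound (C := B) (n := k) (by fun_prop) fun p => ?_
    rw [abs_mul, abs_pow, mul_comm]
    have := abs_fst_le p
    have := hYb p
    gcongr
  have j2 := jm j0 (by fun_prop) hM b0 2
  have jp : Integrable (fun p => ph (WW F r m0 p) * dx F (r • p)) mu :=
    int_of_bound (C := C) (n := 0) (by fun_prop) (by simpa using b1)
  have j3 : Integrable (fun p => p.1 * (ph (WW F r m0 p) * dx F (r • p))) mu := by
    simpa using jm jp (by fun_prop) hC b1 1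
  have j4 : Integrable (fun p => ph (WW F r m0 p) * dx (dx F) (r • p)) mu :=
    int_of_bound (C := D) (n := 0) (by fun_prop) (by simpa using b2)
  have j5 : Integrable (fun p => WW F r m0 p * ph (WW F r m0 p) * (dx F (r • p) * dx F (r • p))) mu :=
    int_of_bound (C := C * C) (n := 0) (by fun_prop) (by simpa using b3)
  have e3 : ∫ p, (p.1 ^ 2 - 1) * ps (WW F r m0 p) ∂mu
      = ∫ p, p.1 * (p.1 * ps (WW F r m0 p)) ∂mu - ∫ p, ps (WW F r m0 p) ∂mu := by
    rw [← integral_sub (by refine j2.congr (ae_of_all _ fun p => by ring_nf)) j0]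
    congr 1; ext p; ring
  rw [e3, e1, integral_add j0 j3, e2, integral_sub (j4.const_mul r) j5, integral_const_mul]
  ring

end Stein


/-! ### The core expansion -/

set_option maxHeartbeats 2000000 in
lemma core_algebra {C1 C2 C3 C4 C5 C6 C7 K qb Qb T L a : ℝ} (h1 : 0 ≤ C1) (h2 : 0 ≤ C2)
    (h3 : 0 ≤ C3) (h4 : 0 ≤ C4) (h5 : 0 ≤ C5) (h6 : 0 ≤ C6) (h7 : 0 ≤ C7) (hK : 0 ≤ K) :
    ∃ C, 0 ≤ C ∧ ∀ r e0 J2 J3 J4 I5 J6 J7 m0 m1 m2 : ℝ, 0 < r → r ≤ 1 →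
      C1 * r ^ 2 ≤ 1 / 4 → K * r ^ 6 ≤ 1 / 8 → |e0 - 1| ≤ C1 * r ^ 2 → |J2| ≤ C2 * r ^ 1 →
      |J3| ≤ C3 * r ^ 3 → |J4| ≤ C4 * r ^ 2 → |I5 - (r * qb - m0)| ≤ C5 * r ^ 3 →
      |J6 - r ^ 2 * Qb| ≤ C6 * r ^ 4 → |J7 - r ^ 2 * (r * T - m0 * L)| ≤ C7 * r ^ 5 →
      |I5| ≤ K * r ^ 6 → |J4 - m1 * e0| ≤ K * r ^ 6 * (1 + |m1|) →
      |(r * (J6 + a * e0) - J7) + 2 * m1 * J3 - m1 ^ 2 * J2 - m2 * e0|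
        ≤ K * r ^ 6 * (1 + |m1| + m1 ^ 2 + |m2|) →
      |m2 - r * (a + r ^ 2 * (Qb - T + qb * L))| ≤ C * r ^ 5 := by
  set A := Qb - T + qb * L with hA
  set D1 := 2 * (C4 + K) with hD1
  set C' := C6 + C7 + (C5 + K) * |L| + 2 * D1 * C3 + D1 ^ 2 * C2 + K * (1 + D1 + D1 ^ 2) + K * |a|
    with hC'
  set D2 := 2 * (C' + |A|) with hD2
  have hD1n : 0 ≤ D1 := by positivity
  have hCn : 0 ≤ C' := by positivity
  have hD2n : 0 ≤ D2 := by positivity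
  refine ⟨C' + K * D2 + D2 * C1, by positivity, ?_⟩
  intro r e0 J2 J3 J4 I5 J6 J7 m0 m1 m2 hr hr1 s1 s2 b1 b2 b3 b4 b5 b6 b7 H1 H2 H3
  have hp : ∀ i j : ℕ, j ≤ i → r ^ i ≤ r ^ j := fun i j hij =>
    pow_le_pow_of_le_one hr.le hr1 hij
  have e0l : 3 / 4 ≤ e0 := by have := (abs_le.1 b1).1; linarith
  have hm0 : |r * qb - m0| ≤ (C5 + K) * r ^ 3 := by
    have : r * qb - m0 = I5 - (I5 - (r * qb - m0)) := by ring
    rw [this]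
    refine (abs_sub _ _).trans ?_
    have := mul_le_mul_of_nonneg_left (hp 6 3 (by norm_num)) hK
    linarith
  have hm1 : |m1| ≤ D1 * r ^ 2 := by
    have e : |m1| * e0 ≤ C4 * r ^ 2 + K * r ^ 6 * (1 + |m1|) := by
      have : |m1| * e0 = |J4 - (J4 - m1 * e0)| := by
        rw [sub_sub_cancel, abs_mul, abs_of_pos (by linarith : (0:ℝ) < e0)]
      rw [this]
      refine (abs_sub _ _).trans ?_
      linarith
    have := mul_le_mul_of_nonneg_left (hp 6 2 (by norm_num)) hK
    nlinarith [abs_nonneg m1, mul_nonneg h4 (sq_nonneg r), mul_nonneg hK (sq_nonneg r)]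
  have hm1' : |m1| ≤ D1 := hm1.trans (by nlinarith [hp 2 0 (by norm_num)])
  have hm1sq : m1 ^ 2 ≤ D1 ^ 2 * r ^ 4 := by
    rw [← sq_abs]
    calc |m1| ^ 2 ≤ (D1 * r ^ 2) ^ 2 := by gcongr
      _ = _ := by ring
  have hm1sq' : m1 ^ 2 ≤ D1 ^ 2 := by
    rw [← sq_abs]; gcongr
  have r5 : 0 < r ^ 5 := by positivity
  set X := (m2 - r * a) * e0 - r ^ 3 * A with hX
  have hXb : |X| ≤ C' * r ^ 5 + K * r ^ 6 * |m2 - r * a| := by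
    set R := (r * (J6 + a * e0) - J7) + 2 * m1 * J3 - m1 ^ 2 * J2 - m2 * e0 with hR
    have eX : X = r * (J6 - r ^ 2 * Qb) - (J7 - r ^ 2 * (r * T - m0 * L))
        + r ^ 2 * ((r * qb - m0) * L) * (-1) + 2 * m1 * J3 - m1 ^ 2 * J2 - R := by
      rw [hX, hR, hA]; ring
    have t1 : |r * (J6 - r ^ 2 * Qb)| ≤ C6 * r ^ 5 := by
      rw [abs_mul, abs_of_pos hr]
      calc _ ≤ r * (C6 * r ^ 4) := by gcongr
        _ = _ := by ring
    have t3 : |r ^ 2 * ((r * qb - m0) * L) * (-1)| ≤ (C5 + K) * |L| * r ^ 5 := by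
      rw [abs_mul, abs_mul, abs_mul _ L, abs_of_pos (by positivity : 0 < r ^ 2)]
      calc _ ≤ r ^ 2 * (((C5 + K) * r ^ 3) * |L|) * |(-1 : ℝ)| := by gcongr
        _ = _ := by norm_num; ring
    have t4 : |2 * m1 * J3| ≤ 2 * D1 * C3 * r ^ 5 := by
      rw [abs_mul, abs_mul]
      calc _ ≤ |(2:ℝ)| * (D1 * r ^ 2) * (C3 * r ^ 3) := by gcongr
        _ = _ := by norm_num; ring
    have t5 : |m1 ^ 2 * J2| ≤ D1 ^ 2 * C2 * r ^ 5 := by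
      rw [abs_mul, abs_of_nonneg (sq_nonneg m1)]
      calc _ ≤ (D1 ^ 2 * r ^ 4) * (C2 * r ^ 1) := by gcongr
        _ = _ := by ring
    have t6 : |R| ≤ (K * (1 + D1 + D1 ^ 2) + K * |a|) * r ^ 5 + K * r ^ 6 * |m2 - r * a| := by
      refine H3.trans ?_
      have : |m2| ≤ |m2 - r * a| + |a| := by
        have e : m2 = (m2 - r * a) + r * a := by ring
        calc |m2| = |(m2 - r * a) + r * a| := by rw [← e]
          _ ≤ |m2 - r * a| + |r * a| := abs_add_le _ _
          _ ≤ _ := by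
            rw [abs_mul, abs_of_pos hr]
            nlinarith [abs_nonneg a]
      calc _ ≤ K * r ^ 6 * (1 + D1 + D1 ^ 2 + (|m2 - r * a| + |a|)) := by gcongr
        _ = K * (1 + D1 + D1 ^ 2 + |a|) * r ^ 6 + K * r ^ 6 * |m2 - r * a| := by ring
        _ ≤ K * (1 + D1 + D1 ^ 2 + |a|) * r ^ 5 + K * r ^ 6 * |m2 - r * a| := by
          have := mul_le_mul_of_nonneg_left (hp 6 5 (by norm_num))
            (by positivity : 0 ≤ K * (1 + D1 + D1 ^ 2 + |a|))
          linarith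
        _ = _ := by ring
    rw [eX]
    refine (abs_sub _ _).trans ?_
    refine (add_le_add ((abs_sub _ _).trans (add_le_add ((abs_add_le _ _).trans (add_le_add
      ((abs_add_le _ _).trans (add_le_add ((abs_sub _ _).trans (add_le_add t1 b7)) t3)) t4)) t5))
      t6).trans ?_
    rw [hC']
    apply le_of_eq; ring
  have hZ : |m2 - r * a| ≤ D2 * r ^ 3 := by
    have e : |m2 - r * a| * e0 ≤ C' * r ^ 5 + K * r ^ 6 * |m2 - r * a| + r ^ 3 * |A| := by
      have : |m2 - r * a| * e0 = |X + r ^ 3 * A| := by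
        rw [hX, sub_add_cancel, abs_mul, abs_of_pos (by linarith : (0:ℝ) < e0)]
      rw [this]
      refine (abs_add_le _ _).trans ?_
      rw [abs_mul _ A, abs_of_pos (by positivity : 0 < r ^ 3)]
      linarith
    have k1 := mul_le_mul_of_nonneg_left (hp 5 3 (by norm_num)) hCn
    have k2 : 0 ≤ r ^ 3 := by positivity
    nlinarith [abs_nonneg (m2 - r * a), mul_nonneg hCn k2, mul_nonneg (abs_nonneg A) k2]
  have e : m2 - r * (a + r ^ 2 * A) = X - (m2 - r * a) * (e0 - 1) := by rw [hX]; ring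
  rw [e]
  refine (abs_sub _ _).trans ?_
  rw [abs_mul]
  have k1 : |m2 - r * a| * |e0 - 1| ≤ D2 * r ^ 3 * (C1 * r ^ 2) := by gcongr
  have k2 : K * r ^ 6 * |m2 - r * a| ≤ K * r ^ 6 * (D2 * r ^ 3) := by gcongr
  have k3 : K * r ^ 6 * (D2 * r ^ 3) ≤ K * D2 * r ^ 5 := by
    have := mul_le_mul_of_nonneg_left (hp 9 5 (by norm_num)) (mul_nonneg hK hD2n)
    calc _ = K * D2 * r ^ 9 := by ring
      _ ≤ _ := this
  calc _ ≤ C' * r ^ 5 + K * D2 * r ^ 5 + D2 * r ^ 3 * (C1 * r ^ 2) := by linarith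
    _ = _ := by ring

lemma int_q {F : ℝ × ℝ → ℝ} (hF : Sm F) (r m0 : ℝ) : ∫ p, (r * (TD F 2 p / 2) - m0) ∂mu
    = r * ((dx (dx F) 0 + dy (dy F) 0) / 2) - m0 := by
  have h := poly_two (r * (dx (dx F) 0) / 2) (r * dx (dy F) 0) (r * (dy (dy F) 0) / 2)
  have i : Integrable (fun p => r * (TD F 2 p / 2)) mu := by
    have : Big (fun _ : Unit => (1 : ℝ)) 0 (fun _ p => TD F 2 p) := TD_big _ 2
    exact ((this.integrable ()).div_const 2).const_mul r
  rw [integral_sub i (integrable_const _)]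
  simp only [integral_const, probReal_univ, smul_eq_mul, one_mul]
  congr 1
  rw [show r * ((dx (dx F) 0 + dy (dy F) 0) / 2) = r * (dx (dx F) 0) / 2 + r * (dy (dy F) 0) / 2 by ring,
    ← h]
  congr 1; ext p; rw [TD_two hF]; ring

lemma int_QQ {F : ℝ × ℝ → ℝ} (hF : Sm F) (r : ℝ) : ∫ p, r ^ 2 * (TD F 2 p / 2) ∂mu
    = r ^ 2 * ((dx (dx F) 0 + dy (dy F) 0) / 2) := by
  have := int_q hF (r ^ 2) 0
  simpa using this

lemma int_seven {F : ℝ × ℝ → ℝ} (hF : Sm F) (r m0 : ℝ) :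
    ∫ p, r ^ 2 * ((r * (TD F 2 p / 2) - m0) * (TD (dx F) 1 p * TD (dx F) 1 p)) ∂mu
    = r ^ 2 * (r * ((3 * dx (dx F) 0 ^ 3 + 5 * dx (dx F) 0 * dx (dy F) 0 ^ 2
        + dy (dy F) 0 * dx (dx F) 0 ^ 2 + 3 * dy (dy F) 0 * dx (dy F) 0 ^ 2) / 2)
      - m0 * (dx (dx F) 0 ^ 2 + dx (dy F) 0 ^ 2)) := by
  set a := dx (dx F) 0
  set b := dx (dy F) 0 with hb
  set d := dy (dy F) 0
  have hb' : dy (dx F) 0 = b := by rw [hb, hF.dx_dy]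
  have h4 := poly_four (r * a ^ 3 / 2) (r * (4 * a ^ 2 * b) / 2)
    (r * (5 * a * b ^ 2 + d * a ^ 2) / 2) (r * (2 * b ^ 3 + 2 * a * b * d) / 2) (r * (d * b ^ 2) / 2)
  have h2 := poly_two (m0 * a ^ 2) (m0 * (2 * a * b)) (m0 * b ^ 2)
  have bg : ∀ (G : ℝ × ℝ → ℝ) k, Big (fun _ : Unit => (1 : ℝ)) 0 (fun _ p => TD G k p) :=
    fun G k => TD_big G k
  have hr1 : ∀ _ : Unit, 0 < (1 : ℝ) ∧ (1 : ℝ) ≤ 1 := fun _ => by norm_num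
  have hl := (bg (dx F) 1).mul hr1 (bg (dx F) 1)
  have i1 : Integrable (fun p => r * (TD F 2 p / 2) * (TD (dx F) 1 p * TD (dx F) 1 p)) mu := by
    have := ((((bg F 2).mul hr1 hl).integrable ()).const_mul (r / 2))
    refine this.congr (ae_of_all _ fun p => ?_)
    simp only; ring
  have i2 : Integrable (fun p => m0 * (TD (dx F) 1 p * TD (dx F) 1 p)) mu :=
    (hl.integrable ()).const_mul m0
  rw [integral_const_mul]
  have e : ∀ p, (r * (TD F 2 p / 2) - m0) * (TD (dx F) 1 p * TD (dx F) 1 p)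
      = r * (TD F 2 p / 2) * (TD (dx F) 1 p * TD (dx F) 1 p)
        - m0 * (TD (dx F) 1 p * TD (dx F) 1 p) := fun p => by ring
  simp_rw [e]
  rw [integral_sub i1 i2]
  have e1 : ∫ p, r * (TD F 2 p / 2) * (TD (dx F) 1 p * TD (dx F) 1 p) ∂mu = _ :=
    Eq.trans (by congr 1; ext p; rw [TD_two hF, TD_one, hb']; ring) h4
  have e2 : ∫ p, m0 * (TD (dx F) 1 p * TD (dx F) 1 p) ∂mu = _ :=
    Eq.trans (by congr 1; ext p; rw [TD_one, hb']; ring) h2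
  rw [e1, e2]
  ring

/-- the coefficient of `t` in the expansion of `h_xx` -/
noncomputable def coefA (F : ℝ × ℝ → ℝ) : ℝ :=
  (dx (dx (dx (dx F))) 0 + dy (dy (dx (dx F))) 0) / 2
    - (dx (dx F) 0 ^ 3 + 2 * dx (dx F) 0 * dx (dy F) 0 ^ 2 + dy (dy F) 0 * dx (dy F) 0 ^ 2)

lemma m0_bound {F : ℝ × ℝ → ℝ} {K0 : ℝ} (hF : Sm F) (hc : HasCompactSupport F) (h0 : F 0 = 0)
    (hx : dx F 0 = 0) (hy : dy F 0 = 0) (hK0 : 0 ≤ K0) :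
    ∃ K r0, 0 ≤ K ∧ 0 < r0 ∧ r0 ≤ 1 ∧ ∀ r m0, 0 < r → r < r0 →
      |∫ p, ps (WW F r m0 p) ∂mu| ≤ K0 * r ^ 6 → |m0| ≤ K * r := by
  obtain ⟨C, hC, ht⟩ := taylor hF hc 1
  have hb : ∀ r p, 0 < r → |F (r • p) / r| ≤ C * r * (1 + ‖p‖) ^ 2 := by
    intro r p hr
    have h1 := ht r p hr.le
    simp only [Finset.sum_range_succ, Finset.sum_range_zero, TD_zero, TD_one, h0, hx, hy] at h1
    simp only [mul_zero, add_zero, sub_zero] at h1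
    rw [abs_div, abs_of_pos hr, div_le_iff₀ hr]
    refine h1.trans (le_of_eq (by ring))
  set I := ∫ p : ℝ × ℝ, (1 + ‖p‖) ^ 2 ∂mu with hI
  have hI0 : 0 ≤ I := integral_nonneg fun p => by positivity
  set K := 2 * (C * I + K0) with hK
  have hKn : 0 ≤ K := by positivity
  refine ⟨K, 1 / (K + 1), hKn, by positivity, ?_, ?_⟩
  · rw [div_le_one (by positivity)]; linarith
  intro r m0 hr hr0 h
  have hr1 : r * (K + 1) < 1 := by rwa [lt_div_iff₀ (by positivity)] at hr0
  have hrle : r ≤ 1 := by nlinarith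
  obtain ⟨M, hM, hbM⟩ := ps_bdd
  have i1 : Integrable (fun p => ps (WW F r m0 p)) mu := by
    have := WW_cont hF r m0
    have := ps_cont
    exact int_of_bound (C := M) (n := 0) (by fun_prop) (by simpa using fun p q => hbM _)
  have key : |∫ p, ps (WW F r m0 p) ∂mu - ps (-m0)| ≤ C * r * I := by
    have e : ∫ p, ps (WW F r m0 p) ∂mu - ps (-m0) = ∫ p, (ps (WW F r m0 p) - ps (-m0)) ∂mu := by
      rw [integral_sub i1 (integrable_const _)]; simp
    rw [e, hI, ← integral_const_mul, ← Real.norm_eq_abs]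
    refine norm_integral_le_of_norm_le ((int_poly 2).const_mul _) (ae_of_all _ fun p => ?_)
    rw [Real.norm_eq_abs]
    refine (ps_lip _ _).trans ?_
    have : WW F r m0 p - -m0 = F (r • p) / r := by simp [WW]
    rw [this]
    exact hb r p hr
  have hps : |ps (-m0)| ≤ (C * I + K0) * r := by
    have e : ps (-m0) = ∫ p, ps (WW F r m0 p) ∂mu - (∫ p, ps (WW F r m0 p) ∂mu - ps (-m0)) := by ring
    rw [e]
    refine (abs_sub _ _).trans ?_
    have : r ^ 6 ≤ r ^ 1 := pow_le_pow_of_le_one hr.le hrle (by norm_num)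
    have := mul_le_mul_of_nonneg_left this hK0
    linarith
  have hl := ps_lower (-m0)
  rw [abs_neg] at hl
  have hmin : min |m0| 1 ≤ K * r := by rw [hK]; linarith
  rcases min_le_iff.1 hmin with h1 | h1
  · exact h1
  · nlinarith

theorem core {F : ℝ × ℝ → ℝ} {K0 : ℝ} (hF : Sm F) (hc : HasCompactSupport F) (h0 : F 0 = 0)
    (hx : dx F 0 = 0) (hy : dy F 0 = 0) (hK0 : 0 ≤ K0) :
    ∃ C r0, 0 ≤ C ∧ 0 < r0 ∧ r0 ≤ 1 ∧ ∀ r m0 m1 m2, 0 < r → r < r0 →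
      |∫ p, ps (WW F r m0 p) ∂mu| ≤ K0 * r ^ 6 →
      |∫ p, p.1 * ps (WW F r m0 p) ∂mu - m1 * ∫ p, ph (WW F r m0 p) ∂mu| ≤ K0 * r ^ 6 * (1 + |m1|) →
      |∫ p, (p.1 ^ 2 - 1) * ps (WW F r m0 p) ∂mu - 2 * m1 * ∫ p, p.1 * ph (WW F r m0 p) ∂mu
        - m1 ^ 2 * ∫ p, WW F r m0 p * ph (WW F r m0 p) ∂mu - m2 * ∫ p, ph (WW F r m0 p) ∂mu|
        ≤ K0 * r ^ 6 * (1 + |m1| + m1 ^ 2 + |m2|) →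
      |m2 - r * (dx (dx F) 0 + r ^ 2 * coefA F)| ≤ C * r ^ 5 := by
  obtain ⟨K, r0, hK, hr0, hr01, hm0⟩ := m0_bound hF hc h0 hx hy hK0
  let ι := {x : ℝ × ℝ // (0 < x.1 ∧ x.1 ≤ 1) ∧ |x.2| ≤ K * x.1}
  have P : Pack ι (fun i => i.1.1) (fun i => i.1.2) F :=
    mkPack (fun i => i.2.1) (fun i => i.2.2) hF hc h0 hx hy
  obtain ⟨C1, n1, b1⟩ := P.e_one
  obtain ⟨C2, n2, b2⟩ := P.e_two
  obtain ⟨C3, n3, b3⟩ := P.e_three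
  obtain ⟨C4, n4, b4⟩ := P.e_four
  obtain ⟨C5, n5, b5⟩ := P.e_five
  obtain ⟨C6, n6, b6⟩ := P.e_six
  obtain ⟨C7, n7, b7⟩ := P.e_seven
  obtain ⟨C, hC, H⟩ := core_algebra (qb := (dx (dx F) 0 + dy (dy F) 0) / 2)
    (Qb := (dx (dx (dx (dx F))) 0 + dy (dy (dx (dx F))) 0) / 2)
    (T := (3 * dx (dx F) 0 ^ 3 + 5 * dx (dx F) 0 * dx (dy F) 0 ^ 2
        + dy (dy F) 0 * dx (dx F) 0 ^ 2 + 3 * dy (dy F) 0 * dx (dy F) 0 ^ 2) / 2)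
    (L := dx (dx F) 0 ^ 2 + dx (dy F) 0 ^ 2) (a := dx (dx F) 0) n1 n2 n3 n4 n5 n6 n7 hK0
  refine ⟨C, min r0 (1 / (8 * (C1 + K0 + 1))), hC, by positivity, (min_le_left _ _).trans hr01, ?_⟩
  intro r m0 m1 m2 hr hrr H1 H2 H3
  have hrr0 := hrr.trans_le (min_le_left _ _)
  have hrs := hrr.trans_le (min_le_right _ _)
  have hr1 : r ≤ 1 := by linarith
  rw [lt_div_iff₀ (by positivity)] at hrs
  have hm := hm0 r m0 hr hrr0 H1
  let i : ι := ⟨(r, m0), ⟨hr, hr1⟩, hm⟩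
  have hp2 : r ^ 2 ≤ r := by nlinarith
  have hp6 : r ^ 6 ≤ r := by simpa using pow_le_pow_of_le_one hr.le hr1 (by norm_num : 1 ≤ 6)
  have j1 : Integrable (fun p => ph (WW F r m0 p)) mu := P.P0.integrable i
  have j2 : Integrable (fun p => ph (WW F r m0 p) * (dx (dx F) (r • p) - dx (dx F) 0)) mu :=
    (P.P0.mul P.hr P.D0).integrable i
  have e6 : ∫ p, ph (WW F r m0 p) * dx (dx F) (r • p) ∂mu
      = ∫ p, ph (WW F r m0 p) * (dx (dx F) (r • p) - dx (dx F) 0) ∂mu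
        + dx (dx F) 0 * ∫ p, ph (WW F r m0 p) ∂mu := by
    rw [← integral_const_mul, ← integral_add j2 (j1.const_mul _)]
    congr 1; ext p; ring
  have B5 := b5 i
  have B6 := b6 i
  have B7 := b7 i
  rw [int_q hF] at B5
  rw [int_QQ hF.dx.dx] at B6
  rw [int_seven hF] at B7
  rw [S_one hF hc hr] at H2
  rw [S_three hF hc hr, S_two hF hc hr, e6] at H3
  have := H r _ _ _ _ _ _ _ m0 m1 m2 hr hr1 (by nlinarith) (by nlinarith) (b1 i) (b2 i) (b3 i) (b4 i)
    B5 B6 B7 H1 H2 (by convert H3 using 2; ring)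
  convert this using 5
  rw [coefA]; ring

/-! ### Removing the compact support assumption -/

lemma exists_cutoff {f : ℝ × ℝ → ℝ} (hf : Sm f) : ∃ F, Sm F ∧ HasCompactSupport F ∧
    ∀ q, ‖q‖ ≤ 1 → F q = f q := by
  let b : ContDiffBump (0 : ℝ × ℝ) := ⟨1, 2, by norm_num, by norm_num⟩
  refine ⟨fun q => b q * f q, ContDiff.mul b.contDiff hf, b.hasCompactSupport.mul_right, fun q hq => ?_⟩
  have : b q = 1 := b.one_of_mem_closedBall (by simpa using hq)
  simp [this]

lemma tail {f F : ℝ × ℝ → ℝ} (hf : Sm f) (hF : Sm F) (hfF : ∀ q, ‖q‖ ≤ 1 → F q = f q)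
    {Θ : ℝ → ℝ} (hΘ : Continuous Θ) {M : ℝ} (hM : ∀ a, |Θ a| ≤ M)
    {w : ℝ × ℝ → ℝ} (hw : Continuous w) (hwb : ∀ p, |w p| ≤ (1 + ‖p‖) ^ 2) (r m0 : ℝ) (hr : 0 < r) :
    |∫ p, w p * Θ (WW F r m0 p) ∂mu - ∫ p, w p * Θ (WW f r m0 p) ∂mu|
      ≤ (2 * M * ∫ p : ℝ × ℝ, (1 + ‖p‖) ^ 8 ∂mu) * r ^ 6 := by
  have hM0 : 0 ≤ M := (abs_nonneg _).trans (hM 0)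
  have hi : ∀ {G : ℝ × ℝ → ℝ}, Sm G → Integrable (fun p => w p * Θ (WW G r m0 p)) mu := by
    intro G hG
    have := WW_cont hG r m0
    refine int_of_bound (C := M) (n := 2) (by fun_prop) fun p => ?_
    rw [abs_mul, mul_comm]
    gcongr
    · exact hM _
    · exact hwb p
  rw [← integral_sub (hi hF) (hi hf), ← Real.norm_eq_abs]
  have e : (2 * M * ∫ p : ℝ × ℝ, (1 + ‖p‖) ^ 8 ∂mu) * r ^ 6
      = ∫ p : ℝ × ℝ, (2 * M * r ^ 6) * (1 + ‖p‖) ^ 8 ∂mu := by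
    rw [integral_const_mul]; ring
  rw [e]
  refine norm_integral_le_of_norm_le ((int_poly 8).const_mul _) (ae_of_all _ fun p => ?_)
  rw [Real.norm_eq_abs, ← mul_sub, abs_mul]
  by_cases h : ‖r • p‖ ≤ 1
  · have : WW F r m0 p = WW f r m0 p := by simp only [WW, hfF _ h]
    rw [this, sub_self, abs_zero, mul_zero]
    positivity
  · have h1 : 1 ≤ r * ‖p‖ := by
      rw [norm_smul, Real.norm_eq_abs, abs_of_pos hr] at h; linarith
    have h2 : 1 ≤ r ^ 6 * (1 + ‖p‖) ^ 6 := by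
      rw [← mul_pow]
      exact one_le_pow₀ (by nlinarith)
    have h3 : |Θ (WW F r m0 p) - Θ (WW f r m0 p)| ≤ 2 * M :=
      (abs_sub _ _).trans (by linarith [hM (WW F r m0 p), hM (WW f r m0 p)])
    calc |w p| * |Θ (WW F r m0 p) - Θ (WW f r m0 p)| ≤ (1 + ‖p‖) ^ 2 * (2 * M) := by
          gcongr; exact hwb p
      _ ≤ (1 + ‖p‖) ^ 2 * (2 * M) * (r ^ 6 * (1 + ‖p‖) ^ 6) := le_mul_of_one_le_right (by positivity) h2
      _ = _ := by ring

theorem core_f {f : ℝ × ℝ → ℝ} (hf : Sm f) (h0 : f 0 = 0) (hx : dx f 0 = 0) (hy : dy f 0 = 0) :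
    ∃ C r0, 0 ≤ C ∧ 0 < r0 ∧ r0 ≤ 1 ∧ ∀ r m0 m1 m2, 0 < r → r < r0 →
      ∫ p, ps (WW f r m0 p) ∂mu = 0 →
      ∫ p, p.1 * ps (WW f r m0 p) ∂mu - m1 * ∫ p, ph (WW f r m0 p) ∂mu = 0 →
      ∫ p, (p.1 ^ 2 - 1) * ps (WW f r m0 p) ∂mu - 2 * m1 * ∫ p, p.1 * ph (WW f r m0 p) ∂mu
        - m1 ^ 2 * ∫ p, WW f r m0 p * ph (WW f r m0 p) ∂mu - m2 * ∫ p, ph (WW f r m0 p) ∂mu = 0 →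
      |m2 - r * (dx (dx f) 0 + r ^ 2 * coefA f)| ≤ C * r ^ 5 := by
  obtain ⟨F, hF, hc, hfF⟩ := exists_cutoff hf
  have hev : F =ᶠ[nhds 0] f := by
    filter_upwards [Metric.closedBall_mem_nhds (0 : ℝ × ℝ) one_pos] with q hq
    exact hfF q (by simpa using hq)
  have ex := dx_congr hev
  have ey := dy_congr hev
  have exx := dx_congr ex
  have exy := dx_congr ey
  have eyy := dy_congr ey
  have exxxx := dx_congr (dx_congr exx)
  have eyyxx := dy_congr (dy_congr exx)
  have hA : coefA F = coefA f := by
    unfold coefA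
    rw [exx.eq_of_nhds, exy.eq_of_nhds, eyy.eq_of_nhds, exxxx.eq_of_nhds, eyyxx.eq_of_nhds]
  obtain ⟨M, hM, hbM⟩ := ps_bdd
  set I := ∫ p : ℝ × ℝ, (1 + ‖p‖) ^ 8 ∂mu with hI
  have hI0 : 0 ≤ I := integral_nonneg fun p => by positivity
  set κ := 2 * (M + 1) * I with hκ
  have hκ0 : 0 ≤ κ := by positivity
  obtain ⟨C, r0, hC, hr0, hr01, H⟩ := core (K0 := 2 * κ) hF hc (hev.eq_of_nhds.trans h0)
    (ex.eq_of_nhds.trans hx) (ey.eq_of_nhds.trans hy) (by positivity)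
  refine ⟨C, r0, hC, hr0, hr01, fun r m0 m1 m2 hr hrr H1 H2 H3 => ?_⟩
  have hle : ∀ p : ℝ × ℝ, 1 ≤ 1 + ‖p‖ := fun p => by linarith [norm_nonneg p]
  have w0 : ∀ p : ℝ × ℝ, |(1 : ℝ)| ≤ (1 + ‖p‖) ^ 2 := fun p => by
    rw [abs_one]; exact one_le_pow₀ (hle p)
  have w1 : ∀ p : ℝ × ℝ, |p.1| ≤ (1 + ‖p‖) ^ 2 := fun p => by
    have := abs_fst_le p
    nlinarith [hle p]
  have w2 : ∀ p : ℝ × ℝ, |p.1 ^ 2 - 1| ≤ (1 + ‖p‖) ^ 2 := fun p => by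
    have := abs_fst_le p
    have h2 : |p.1| ^ 2 ≤ (1 + ‖p‖) ^ 2 := by gcongr
    rw [sq_abs] at h2
    rw [abs_le]; constructor <;> nlinarith [hle p, sq_nonneg p.1]
  have c1 := ps_cont
  have c2 := ph_cont
  have hb1 : ∀ a, |ps a| ≤ M + 1 := fun a => (hbM a).trans (by linarith)
  have hb2 : ∀ a, |ph a| ≤ M + 1 := fun a => by
    rw [abs_of_pos (ph_pos a)]; linarith [ph_le_one a]
  have hb3 : ∀ a, |a * ph a| ≤ M + 1 := fun a => (mul_ph_le a).trans (by linarith)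
  have t1 := tail hf hF hfF c1 hb1 continuous_const w0 r m0 hr
  have t2 := tail hf hF hfF c1 hb1 continuous_fst w1 r m0 hr
  have t3 := tail hf hF hfF c1 hb1 (by fun_prop) w2 r m0 hr
  have t4 := tail hf hF hfF c2 hb2 continuous_const w0 r m0 hr
  have t5 := tail hf hF hfF c2 hb2 continuous_fst w1 r m0 hr
  have t6 := tail hf hF hfF (Θ := fun a => a * ph a) (by fun_prop) hb3 continuous_const w0 r m0 hr
  simp only [one_mul] at t1 t4 t6
  rw [← hI, ← hκ] at t1 t2 t3 t4 t5 t6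
  have hr6 : 0 < r ^ 6 := by positivity
  have hk : 0 ≤ κ * r ^ 6 := by positivity
  have := H r m0 m1 m2 hr hrr ?_ ?_ ?_
  · rwa [hA, exx.eq_of_nhds] at this
  · rw [H1, sub_zero] at t1
    nlinarith
  · have e : ∫ p, p.1 * ps (WW F r m0 p) ∂mu - m1 * ∫ p, ph (WW F r m0 p) ∂mu
        = (∫ p, p.1 * ps (WW F r m0 p) ∂mu - ∫ p, p.1 * ps (WW f r m0 p) ∂mu)
          - m1 * (∫ p, ph (WW F r m0 p) ∂mu - ∫ p, ph (WW f r m0 p) ∂mu) := by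
      linear_combination H2
    rw [e]
    refine (abs_sub _ _).trans ?_
    rw [abs_mul]
    have := mul_le_mul_of_nonneg_left t4 (abs_nonneg m1)
    nlinarith [mul_nonneg hk (abs_nonneg m1)]
  · have e : ∫ p, (p.1 ^ 2 - 1) * ps (WW F r m0 p) ∂mu - 2 * m1 * ∫ p, p.1 * ph (WW F r m0 p) ∂mu
        - m1 ^ 2 * ∫ p, WW F r m0 p * ph (WW F r m0 p) ∂mu - m2 * ∫ p, ph (WW F r m0 p) ∂mu
        = (∫ p, (p.1 ^ 2 - 1) * ps (WW F r m0 p) ∂mu - ∫ p, (p.1 ^ 2 - 1) * ps (WW f r m0 p) ∂mu)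
          - 2 * (m1 * (∫ p, p.1 * ph (WW F r m0 p) ∂mu - ∫ p, p.1 * ph (WW f r m0 p) ∂mu))
          - m1 ^ 2 * (∫ p, WW F r m0 p * ph (WW F r m0 p) ∂mu
            - ∫ p, WW f r m0 p * ph (WW f r m0 p) ∂mu)
          - m2 * (∫ p, ph (WW F r m0 p) ∂mu - ∫ p, ph (WW f r m0 p) ∂mu) := by
      linear_combination H3
    rw [e]
    refine (abs_sub _ _).trans ?_
    refine (add_le_add_left ((abs_sub _ _).trans (add_le_add_left (abs_sub _ _) _)) _).trans ?_
    rw [abs_mul m2, abs_mul (m1 ^ 2), abs_mul 2, abs_mul m1, abs_of_nonneg (sq_nonneg m1), abs_two]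
    have k1 := mul_le_mul_of_nonneg_left t4 (abs_nonneg m2)
    have k2 := mul_le_mul_of_nonneg_left t5 (abs_nonneg m1)
    have k3 := mul_le_mul_of_nonneg_left t6 (sq_nonneg m1)
    have k4 := mul_nonneg hk (abs_nonneg m1)
    have k5 := mul_nonneg hk (abs_nonneg m2)
    have k6 := mul_nonneg hk (sq_nonneg m1)
    linarith

/-! ### Differentiating the level set equation -/

lemma gauss_shift (ξ x x0 : ℝ) (h : |x - x0| ≤ 1) :
    exp (-(ξ - x) ^ 2 / 4) ≤ exp (1 / 4) * exp (-(ξ - x0) ^ 2 / 8) := by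
  rw [← exp_add]
  apply exp_le_exp.2
  have : (x - x0) ^ 2 ≤ 1 := by rw [← sq_abs]; nlinarith [abs_nonneg (x - x0)]
  nlinarith [sq_nonneg ((ξ - x) - (x - x0))]

lemma gauss_eighth (x0 : ℝ) : Integrable (fun ξ : ℝ => exp (-(ξ - x0) ^ 2 / 8)) := by
  have h := (integrable_exp_neg_mul_sq (b := 1 / 8) (by norm_num)).comp_sub_right x0
  refine h.congr (ae_of_all _ fun x => ?_)
  simp only
  congr 1; ring

lemma deriv_under {B : ℝ × ℝ → ℝ} (hB : Continuous B) {N N' Θ Θ' m : ℝ → ℝ}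
    (hN : ∀ u, HasDerivAt N (N' u) u) (hN' : Continuous N')
    (bN : ∀ u, |N u| ≤ 4 * exp (-u ^ 2 / 4)) (bN' : ∀ u, |N' u| ≤ 4 * exp (-u ^ 2 / 4))
    (hΘ : ∀ u, HasDerivAt Θ (Θ' u) u) (hΘ' : Continuous Θ') {M : ℝ}
    (bΘ : ∀ u, |Θ u| ≤ M) (bΘ' : ∀ u, |Θ' u| ≤ M) (hm : ContDiff ℝ (⊤ : ℕ∞) m) (x0 : ℝ) :
    HasDerivAt (fun x => ∫ p : ℝ × ℝ, N (p.1 - x) * g p.2 * Θ (B p - m x))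
      ((∫ p : ℝ × ℝ, (-N' (p.1 - x0)) * g p.2 * Θ (B p - m x0))
        - deriv m x0 * ∫ p : ℝ × ℝ, N (p.1 - x0) * g p.2 * Θ' (B p - m x0)) x0 := by
  have hM : 0 ≤ M := (abs_nonneg _).trans (bΘ 0)
  have cN : Continuous N := continuous_iff_continuousAt.2 fun u => (hN u).continuousAt
  have cΘ : Continuous Θ := continuous_iff_continuousAt.2 fun u => (hΘ u).continuousAt
  have cm : Continuous m := hm.continuous
  have cm' : Continuous (deriv m) := hm.continuous_deriv (by norm_cast)
  have hmd : ∀ x, HasDerivAt m (deriv m x) x := fun x =>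
    (hm.differentiable (by norm_num) x).hasDerivAt
  obtain ⟨D, hD⟩ := (isCompact_closedBall x0 1).exists_bound_of_continuousOn cm'.continuousOn
  have hD0 : 0 ≤ D := (norm_nonneg _).trans (hD x0 (Metric.mem_closedBall_self (by norm_num)))
  have gc := g_cont
  let E : ℝ × ℝ → ℝ := fun p => exp (-(p.1 - x0) ^ 2 / 8) * g p.2
  have hE : Integrable E := (gauss_eighth x0).mul_prod g_int
  have base : ∀ (x : ℝ) (Q R : ℝ → ℝ), |x - x0| ≤ 1 → (∀ u, |Q u| ≤ 4 * exp (-u ^ 2 / 4)) →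
      (∀ u, |R u| ≤ M) → ∀ p : ℝ × ℝ,
      |Q (p.1 - x) * g p.2 * R (B p - m x)| ≤ 4 * exp (1 / 4) * M * E p := by
    intro x Q R hx hQ hR p
    rw [abs_mul, abs_mul, abs_of_pos (g_pos p.2)]
    calc _ ≤ (4 * (exp (1 / 4) * exp (-(p.1 - x0) ^ 2 / 8))) * g p.2 * M := by
          have h1 : |Q (p.1 - x)| ≤ 4 * (exp (1 / 4) * exp (-(p.1 - x0) ^ 2 / 8)) :=
            (hQ _).trans (by have := gauss_shift p.1 x x0 hx; linarith)
          have := hR (B p - m x)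
          have := (g_pos p.2).le
          gcongr
      _ = _ := by simp only [E]; ring
  have hx0 : |x0 - x0| ≤ 1 := by simp
  have int0 : ∀ (Q R : ℝ → ℝ), Continuous Q → Continuous R → (∀ u, |Q u| ≤ 4 * exp (-u ^ 2 / 4)) →
      (∀ u, |R u| ≤ M) → Integrable (fun p : ℝ × ℝ => Q (p.1 - x0) * g p.2 * R (B p - m x0)) := by
    intro Q R cQ cR hQ hR
    exact (hE.const_mul _).mono' (by fun_prop) (ae_of_all _ (base x0 Q R hx0 hQ hR))
  have bN'' : ∀ u, |-N' u| ≤ 4 * exp (-u ^ 2 / 4) := fun u => by rw [abs_neg]; exact bN' u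
  have key := hasDerivAt_integral_of_dominated_loc_of_deriv_le (μ := (volume : Measure (ℝ × ℝ)))
    (F := fun x p => N (p.1 - x) * g p.2 * Θ (B p - m x)) (x₀ := x0) (s := Metric.ball x0 1)
    (F' := fun x p => (-N' (p.1 - x)) * g p.2 * Θ (B p - m x)
      - deriv m x * (N (p.1 - x) * g p.2 * Θ' (B p - m x)))
    (bound := fun p => 4 * exp (1 / 4) * M * E p + D * (4 * exp (1 / 4) * M * E p))
    (Metric.ball_mem_nhds x0 one_pos)
    (Filter.Eventually.of_forall fun x => by fun_prop)
    (int0 N Θ cN cΘ bN bΘ)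
    (by fun_prop)
    (ae_of_all _ fun p x hx => ?_)
    ((hE.const_mul _).add ((hE.const_mul _).const_mul D))
    (ae_of_all _ fun p x hx => ?_)
  · have := key.2
    rwa [integral_sub (int0 (fun u => -N' u) Θ (by fun_prop) cΘ bN'' bΘ)
      ((int0 N Θ' cN hΘ' bN bΘ').const_mul _), integral_const_mul] at this
  · have hx1 : |x - x0| ≤ 1 := by
      rw [Metric.mem_ball, Real.dist_eq] at hx; exact hx.le
    have hDx : |deriv m x| ≤ D := hD x (Metric.ball_subset_closedBall hx)
    rw [Real.norm_eq_abs]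
    refine (abs_sub _ _).trans ?_
    rw [abs_mul (deriv m x)]
    have := base x (fun u => -N' u) Θ hx1 bN'' bΘ p
    have := base x N Θ' hx1 bN bΘ' p
    gcongr
  · have h1 : HasDerivAt (fun x => N (p.1 - x)) (-N' (p.1 - x)) x := by
      have := (hN (p.1 - x)).comp x ((hasDerivAt_id x).const_sub p.1)
      exact this.congr_deriv (by ring)
    have h2 : HasDerivAt (fun x => Θ (B p - m x)) (Θ' (B p - m x) * (- deriv m x)) x :=
      (hΘ _).comp x ((hmd x).const_sub (B p))
    refine ((h1.mul_const (g p.2)).mul h2).congr_deriv ?_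
    ring

lemma g_const_le : (√(2 * π))⁻¹ ≤ 1 := by
  apply inv_le_one_of_one_le₀
  rw [Real.one_le_sqrt]
  nlinarith [pi_gt_three]

lemma g_poly_bound (q : ℝ → ℝ) (hq : ∀ u, |q u| ≤ 4 * (1 + u ^ 2 / 4)) (u : ℝ) :
    |q u * g u| ≤ 4 * exp (-u ^ 2 / 4) := by
  have e : exp (-u ^ 2 / 2) = (exp (u ^ 2 / 4))⁻¹ * exp (-u ^ 2 / 4) := by
    rw [← exp_neg, ← exp_add]; congr 1; ring
  have h1 : 1 + u ^ 2 / 4 ≤ exp (u ^ 2 / 4) := by linarith [add_one_le_exp (u ^ 2 / 4)]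
  have hp : 0 < exp (u ^ 2 / 4) := exp_pos _
  have hg : g u ≤ exp (-u ^ 2 / 2) := by
    unfold g
    have := g_const_le
    nlinarith [exp_pos (-u ^ 2 / 2)]
  rw [abs_mul, abs_of_pos (g_pos u)]
  calc |q u| * g u ≤ (4 * exp (u ^ 2 / 4)) * exp (-u ^ 2 / 2) := by
        have := hq u
        have := (g_pos u).le
        gcongr
        linarith
    _ = _ := by rw [e]; field_simp

theorem second_var {f : ℝ × ℝ → ℝ} (hf : Sm f) (r : ℝ) {m : ℝ → ℝ} (hm : ContDiff ℝ (⊤ : ℕ∞) m)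
    (hlev : ∀ᶠ x in nhds (0 : ℝ), ∫ p : ℝ × ℝ, g (p.1 - x) * g p.2 * ps (f (r • p) / r - m x) = 0) :
    ∫ p, ps (WW f r (m 0) p) ∂mu = 0 ∧
    ∫ p, p.1 * ps (WW f r (m 0) p) ∂mu - deriv m 0 * ∫ p, ph (WW f r (m 0) p) ∂mu = 0 ∧
    ∫ p, (p.1 ^ 2 - 1) * ps (WW f r (m 0) p) ∂mu
      - 2 * deriv m 0 * ∫ p, p.1 * ph (WW f r (m 0) p) ∂mu
      - deriv m 0 ^ 2 * ∫ p, WW f r (m 0) p * ph (WW f r (m 0) p) ∂mu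
      - deriv (deriv m) 0 * ∫ p, ph (WW f r (m 0) p) ∂mu = 0 := by
  obtain ⟨M, hM, hbM⟩ := ps_bdd
  have cf : Continuous f := ContDiff.continuous hf
  let B : ℝ × ℝ → ℝ := fun p => f (r • p) / r
  have hB : Continuous B := by unfold B; fun_prop
  have gc := g_cont
  have pc := ph_cont
  have hb1 : ∀ a, |ps a| ≤ M + 1 := fun a => (hbM a).trans (by linarith)
  have hb2 : ∀ a, |ph a| ≤ M + 1 := fun a => by
    rw [abs_of_pos (ph_pos a)]; linarith [ph_le_one a]
  have hb3 : ∀ a, |-a * ph a| ≤ M + 1 := fun a => by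
    rw [neg_mul, abs_neg]; exact (mul_ph_le a).trans (by linarith)
  have n0 : ∀ u, |g u| ≤ 4 * exp (-u ^ 2 / 4) := fun u => by
    have := g_poly_bound (fun _ => 1) (fun u => by simp; nlinarith [sq_nonneg u]) u
    simpa using this
  have n1 : ∀ u, |u * g u| ≤ 4 * exp (-u ^ 2 / 4) := g_poly_bound (fun u => u) (fun u => by
    have := sq_abs u
    nlinarith [sq_nonneg (|u| - 1), abs_nonneg u])
  have n1' : ∀ u, |-u * g u| ≤ 4 * exp (-u ^ 2 / 4) := fun u => by
    rw [neg_mul, abs_neg]; exact n1 u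
  have n2 : ∀ u, |(1 - u ^ 2) * g u| ≤ 4 * exp (-u ^ 2 / 4) :=
    g_poly_bound (fun u => 1 - u ^ 2) (fun u => by
      rw [abs_le]; constructor <;> nlinarith [sq_nonneg u])
  have dug : ∀ u, HasDerivAt (fun u => u * g u) ((1 - u ^ 2) * g u) u := fun u => by
    refine ((hasDerivAt_id u).mul (g_deriv u)).congr_deriv ?_
    simp; ring
  have D1 := fun x => deriv_under hB g_deriv (by fun_prop) n0 n1' ps_deriv pc hb1 hb2 hm x
  have D2 := deriv_under hB dug (by fun_prop) n1 n2 ps_deriv pc hb1 hb2 hm 0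
  have D3 := deriv_under hB g_deriv (by fun_prop) n0 n1' ph_deriv (by fun_prop) hb2 hb3 hm 0
  set F0 : ℝ → ℝ := fun x => ∫ p : ℝ × ℝ, g (p.1 - x) * g p.2 * ps (B p - m x) with hF0
  have hz : F0 =ᶠ[nhds 0] fun _ => 0 := hlev
  have hd : HasDerivAt (deriv m) (deriv (deriv m) 0) 0 := by
    have h1 : ContDiff ℝ (⊤ : ℕ∞) (deriv m) :=
      (contDiff_infty_iff_deriv.1 hm).2
    exact (h1.differentiable (by norm_num) 0).hasDerivAt
  have hz' : ∀ᶠ x in nhds (0 : ℝ), (∫ p : ℝ × ℝ, (p.1 - x) * g (p.1 - x) * g p.2 * ps (B p - m x))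
        - deriv m x * ∫ p : ℝ × ℝ, g (p.1 - x) * g p.2 * ph (B p - m x) = 0 := by
    filter_upwards [hz.eventuallyEq_nhds] with x hx
    have h2 := (D1 x).congr_of_eventuallyEq hx.symm
    have h3 := h2.unique (hasDerivAt_const x (0 : ℝ))
    simpa only [neg_mul, neg_neg] using h3
  have h4 := D2.sub (hd.mul D3)
  have h5 := (h4.congr_of_eventuallyEq (f₁ := fun _ => 0) (hz'.mono fun x hx => hx.symm)).unique
    (hasDerivAt_const (0 : ℝ) (0 : ℝ))
  have h6 := hz'.self_of_nhds
  have h7 : F0 0 = 0 := hz.eq_of_nhds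
  have conv : ∀ (q Θ : ℝ → ℝ), ∫ p, q p.1 * Θ (WW f r (m 0) p) ∂mu
      = ∫ p : ℝ × ℝ, q (p.1 - 0) * g (p.1 - 0) * g p.2 * Θ (B p - m 0) := by
    intro q Θ
    rw [integral_mu]
    congr 1; ext p
    simp only [sub_zero, WW, B]; ring
  have k1 := conv (fun _ => 1) ps
  have k2 := conv (fun u => u) ps
  have k3 := conv (fun u => u ^ 2 - 1) ps
  have k4 := conv (fun _ => 1) ph
  have k5 := conv (fun u => u) ph
  have k6 := conv (fun _ => 1) (fun a => -a * ph a)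
  simp only [one_mul] at k1 k4 k6
  have k6' : ∫ p, WW f r (m 0) p * ph (WW f r (m 0) p) ∂mu
      = -∫ p : ℝ × ℝ, g (p.1 - 0) * g p.2 * (-(B p - m 0) * ph (B p - m 0)) := by
    rw [← k6, ← integral_neg]
    congr 1; ext p; ring
  refine ⟨k1.trans h7, ?_, ?_⟩
  · rw [k2, k4]; exact h6
  · rw [k3, k5, k6', k4]
    have z1 : ∀ p : ℝ × ℝ, -((1 - (p.1 - 0) ^ 2) * g (p.1 - 0)) = ((p.1 - 0) ^ 2 - 1) * g (p.1 - 0) :=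
      fun p => by ring
    have z2 : ∀ p : ℝ × ℝ, -(-(p.1 - 0) * g (p.1 - 0)) = (p.1 - 0) * g (p.1 - 0) :=
      fun p => by ring
    simp only [z1, z2] at h5
    linear_combination h5

/-! ### The convolution as a two dimensional Gaussian integral -/

lemma g_neg (u : ℝ) : g (-u) = g u := by simp [g]

lemma g_half : ∫ u in Set.Iic (0 : ℝ), g u = 1 / 2 := by
  have h1 := integral_comp_neg_Iic 0 g
  simp only [g_neg, neg_zero] at h1
  have h2 := intervalIntegral.integral_Iic_add_Ioi (b := (0 : ℝ)) g_int.integrableOn g_int.integrableOn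
  rw [g_integral] at h2
  linarith

lemma g_Iic (a : ℝ) : ∫ u in Set.Iic a, g u = 1 / 2 + (√(2 * π))⁻¹ * ps a := by
  have h := intervalIntegral.integral_Iic_sub_Iic (a := 0) (b := a) g_int.integrableOn
    g_int.integrableOn
  rw [g_half] at h
  have e : ∫ u in (0 : ℝ)..a, g u = (√(2 * π))⁻¹ * ps a := by
    unfold ps g ph
    rw [intervalIntegral.integral_const_mul]
  linarith

lemma g_ind (a c : ℝ) : ∫ v, g (v - c) * Set.indicator (Set.Iic a) 1 v
    = 1 / 2 + (√(2 * π))⁻¹ * ps (a - c) := by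
  rw [← g_Iic, ← integral_indicator measurableSet_Iic,
    ← integral_sub_right_eq_self (Set.indicator (Set.Iic (a - c)) fun u => g u) c]
  congr 1; ext v
  by_cases hv : v ≤ a
  · rw [Set.indicator_of_mem (by simpa using hv), Set.indicator_of_mem (by simpa using hv)]; simp
  · rw [Set.indicator_of_notMem (by simpa using hv), Set.indicator_of_notMem (by simpa using hv)]
    simp

lemma G3_scale {r : ℝ} (hr : 0 < r) (a b c : ℝ) :
    r ^ 3 * G3 (r ^ 2 / 2) (r * a, r * b, r * c) = g a * g b * g c := by
  have hs : 0 < √(2 * π) := by positivity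
  have e : (4 * π * (r ^ 2 / 2)) = (r * √(2 * π)) ^ 2 := by
    rw [mul_pow, Real.sq_sqrt (by positivity)]; ring
  have e2 : (4 * π * (r ^ 2 / 2)) ^ (-(3 : ℝ) / 2) = ((r * √(2 * π)) ^ 3)⁻¹ := by
    rw [e, ← Real.rpow_natCast (r * √(2 * π)) 2, ← Real.rpow_mul (by positivity)]
    rw [show ((2 : ℕ) : ℝ) * (-(3 : ℝ) / 2) = -((3 : ℕ) : ℝ) by norm_num,
      Real.rpow_neg (by positivity), Real.rpow_natCast]
  simp only [G3, g]
  rw [e2]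
  have e3 : exp (-((r * a) ^ 2 + (r * b) ^ 2 + (r * c) ^ 2) / (4 * (r ^ 2 / 2)))
      = exp (-a ^ 2 / 2) * exp (-b ^ 2 / 2) * exp (-c ^ 2 / 2) := by
    rw [← exp_add, ← exp_add]; congr 1; field_simp; ring
  rw [e3]
  field_simp

lemma conv3_eq {f : ℝ × ℝ → ℝ} (hf : Continuous f) {r : ℝ} (hr : 0 < r) (x y c : ℝ) :
    conv3 (r ^ 2 / 2) (Set.indicator {p : ℝ × ℝ × ℝ | p.2.2 ≤ f (p.1, p.2.1)} 1)
      (r * x, r * y, r * c)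
    = ∫ p : ℝ × ℝ, g (p.1 - x) * g (p.2 - y) *
        (1 / 2 + (√(2 * π))⁻¹ * ps (f (r • p) / r - c)) := by
  set S := {p : ℝ × ℝ × ℝ | p.2.2 ≤ f (p.1, p.2.1)} with hS
  unfold conv3
  set Φ : ℝ × ℝ × ℝ → ℝ := fun q => G3 (r ^ 2 / 2) (r * x - q.1, r * y - q.2.1, r * c - q.2.2) *
    S.indicator 1 q with hΦ
  have : (volume : Measure (ℝ × ℝ)).IsAddHaarMeasure := Measure.prod.instIsAddHaarMeasure _ _
  have : (volume : Measure (ℝ × ℝ × ℝ)).IsAddHaarMeasure := Measure.prod.instIsAddHaarMeasure _ _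
  have hsc := Measure.integral_comp_smul (volume : Measure (ℝ × ℝ × ℝ)) Φ r
  have hdim : Module.finrank ℝ (ℝ × ℝ × ℝ) = 3 := by simp
  rw [hdim, abs_of_pos (by positivity), smul_eq_mul] at hsc
  have h1 : ∫ q, Φ q = ∫ q, r ^ 3 * Φ (r • q) := by
    rw [integral_const_mul, hsc]; field_simp
  let Ψ : (ℝ × ℝ) × ℝ → ℝ := fun z => g (z.1.1 - x) * g (z.1.2 - y) *
    (g (z.2 - c) * Set.indicator (Set.Iic (f (r • z.1) / r)) 1 z.2)
  have h2 : ∀ q, r ^ 3 * Φ (r • q) = Ψ ((q.1, q.2.1), q.2.2) := by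
    rintro ⟨a, b, v⟩
    simp only [hΦ, Ψ, Prod.smul_mk, smul_eq_mul]
    rw [← mul_sub, ← mul_sub, ← mul_sub, ← mul_assoc, G3_scale hr, ← g_neg (a - x), ← g_neg (b - y),
      ← g_neg (v - c), neg_sub, neg_sub, neg_sub, ← mul_assoc]
    congr 1
    have : (r * a, r * b, r * v) ∈ S ↔ v ∈ Set.Iic (f (r * a, r * b) / r) := by
      simp only [hS, Set.mem_ofPred_eq, Set.mem_Iic]
      rw [le_div_iff₀ hr, mul_comm]
    by_cases hv : (r * a, r * b, r * v) ∈ S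
    · rw [Set.indicator_of_mem hv, Set.indicator_of_mem (this.1 hv)]; rfl
    · rw [Set.indicator_of_notMem hv, Set.indicator_of_notMem (fun h => hv (this.2 h))]
  have hmp : MeasurePreserving (MeasurableEquiv.prodAssoc : (ℝ × ℝ) × ℝ ≃ᵐ ℝ × ℝ × ℝ) volume volume :=
    measurePreserving_prodAssoc volume volume volume
  have h3 : ∫ q : ℝ × ℝ × ℝ, Ψ ((q.1, q.2.1), q.2.2) = ∫ z, Ψ z := by
    rw [← hmp.integral_comp MeasurableEquiv.prodAssoc.measurableEmbedding]
    rfl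
  have gc := g_cont
  have hmeas : Measurable Ψ := by
    have hs : MeasurableSet {z : (ℝ × ℝ) × ℝ | z.2 ≤ f (r • z.1) / r} :=
      measurableSet_le (by fun_prop) (by
        have : Continuous fun z : (ℝ × ℝ) × ℝ => f (r • z.1) / r := by fun_prop
        exact this.measurable)
    have e : Ψ = fun z => g (z.1.1 - x) * g (z.1.2 - y) *
      (g (z.2 - c) * Set.indicator {z : (ℝ × ℝ) × ℝ | z.2 ≤ f (r • z.1) / r} 1 z) := by
      funext z
      simp only [Ψ]
      congr 2
    rw [e]
    have k1 : Measurable fun z : (ℝ × ℝ) × ℝ => g (z.1.1 - x) * g (z.1.2 - y) :=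
      (by fun_prop : Continuous fun z : (ℝ × ℝ) × ℝ => g (z.1.1 - x) * g (z.1.2 - y)).measurable
    have k2 : Measurable fun z : (ℝ × ℝ) × ℝ => g (z.2 - c) :=
      (by fun_prop : Continuous fun z : (ℝ × ℝ) × ℝ => g (z.2 - c)).measurable
    exact k1.mul (k2.mul (measurable_one.indicator hs))
  have hIntg : Integrable Ψ := by
    have i := ((g_int.comp_sub_right x).mul_prod (g_int.comp_sub_right y)).mul_prod
      (g_int.comp_sub_right c)
    refine i.mono' hmeas.aestronglyMeasurable (ae_of_all _ fun z => ?_)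
    simp only [Ψ]
    rw [norm_mul, Real.norm_of_nonneg (mul_pos (g_pos _) (g_pos _)).le, norm_mul,
      Real.norm_of_nonneg (g_pos _).le]
    have := (g_pos (z.1.1 - x)).le
    have := (g_pos (z.1.2 - y)).le
    have := (g_pos (z.2 - c)).le
    gcongr
    refine mul_le_of_le_one_right (by assumption) ?_
    by_cases hv : z.2 ∈ Set.Iic (f (r • z.1) / r)
    · rw [Set.indicator_of_mem hv]; simp
    · rw [Set.indicator_of_notMem hv]; simp
  rw [h1]
  simp_rw [h2]
  rw [h3]
  have h4 : ∫ z, Ψ z = ∫ p : ℝ × ℝ, ∫ v : ℝ, Ψ (p, v) := integral_prod Ψ hIntg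
  rw [h4]
  congr 1; ext p
  simp only [Ψ]
  rw [integral_const_mul, g_ind]

lemma level_eq {f : ℝ × ℝ → ℝ} (hf : Continuous f) {r : ℝ} (hr : 0 < r) (x y c : ℝ)
    (h : conv3 (r ^ 2 / 2) (Set.indicator {p : ℝ × ℝ × ℝ | p.2.2 ≤ f (p.1, p.2.1)} 1)
      (r * x, r * y, r * c) = 1 / 2) :
    ∫ p : ℝ × ℝ, g (p.1 - x) * g (p.2 - y) * ps (f (r • p) / r - c) = 0 := by
  rw [conv3_eq hf hr] at h
  obtain ⟨M, hM, hbM⟩ := ps_bdd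
  have i : Integrable fun p : ℝ × ℝ => g (p.1 - x) * g (p.2 - y) :=
    (g_int.comp_sub_right x).mul_prod (g_int.comp_sub_right y)
  have gc := g_cont
  have pc := ps_cont
  have i2 : Integrable fun p : ℝ × ℝ => g (p.1 - x) * g (p.2 - y) * ps (f (r • p) / r - c) := by
    refine (i.mul_const M).mono' ?_ (ae_of_all _ fun p => ?_)
    · exact (by fun_prop : Continuous fun p : ℝ × ℝ =>
        g (p.1 - x) * g (p.2 - y) * ps (f (r • p) / r - c)).aestronglyMeasurable
    · rw [norm_mul, Real.norm_of_nonneg (mul_pos (g_pos _) (g_pos _)).le]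
      exact mul_le_mul_of_nonneg_left (hbM _) (mul_pos (g_pos _) (g_pos _)).le
  have e : ∀ p : ℝ × ℝ, g (p.1 - x) * g (p.2 - y) * (1 / 2 + (√(2 * π))⁻¹ * ps (f (r • p) / r - c))
      = g (p.1 - x) * g (p.2 - y) * (1 / 2)
        + (√(2 * π))⁻¹ * (g (p.1 - x) * g (p.2 - y) * ps (f (r • p) / r - c)) := fun p => by ring
  simp_rw [e] at h
  rw [integral_add (i.mul_const _) (i2.const_mul _), integral_const_mul, integral_mul_const] at h
  have e1 : ∫ p : ℝ × ℝ, g (p.1 - x) * g (p.2 - y) = 1 := by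
    have := integral_prod_mul (μ := volume) (ν := volume) (fun u => g (u - x)) (fun u => g (u - y))
    rw [integral_sub_right_eq_self g, integral_sub_right_eq_self g, g_integral, one_mul] at this
    exact this
  rw [e1] at h
  have hk : (√(2 * π))⁻¹ ≠ 0 := by positivity
  have : (√(2 * π))⁻¹ * ∫ p : ℝ × ℝ, g (p.1 - x) * g (p.2 - y) * ps (f (r • p) / r - c) = 0 := by
    linarith
  exact (mul_eq_zero.1 this).resolve_left hk

/-! ### Assembling the expansion -/

theorem onedim {f : ℝ × ℝ → ℝ} (hf : Sm f) (h0 : f 0 = 0) (hx : dx f 0 = 0) (hy : dy f 0 = 0) :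
    ∃ C r0, 0 ≤ C ∧ 0 < r0 ∧ r0 ≤ 1 ∧ ∀ r, 0 < r → r < r0 → ∀ H : ℝ → ℝ,
      ContDiff ℝ (⊤ : ℕ∞) H →
      (∀ᶠ x in nhds (0 : ℝ), ∫ p : ℝ × ℝ, g (p.1 - x) * g p.2 * ps (f (r • p) / r - H (r * x) / r) = 0)
      → |deriv (deriv H) 0 - (dx (dx f) 0 + r ^ 2 * coefA f)| ≤ C * r ^ 4 := by
  obtain ⟨C, r0, hC, hr0, hr01, h⟩ := core_f hf h0 hx hy
  refine ⟨C, r0, hC, hr0, hr01, fun r hr hrr H hH hl => ?_⟩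
  let m : ℝ → ℝ := fun x => H (r * x) / r
  have hm : ContDiff ℝ (⊤ : ℕ∞) m := by unfold m; fun_prop
  have hH' : ContDiff ℝ (⊤ : ℕ∞) (deriv H) := (contDiff_infty_iff_deriv.1 hH).2
  have d1 : deriv m = fun x => deriv H (r * x) := by
    funext x
    have k := ((hH.differentiable (by norm_num) (r * x)).hasDerivAt.comp x
      ((hasDerivAt_id x).const_mul r)).div_const r
    have k2 : HasDerivAt m (deriv H (r * x)) x := k.congr_deriv (by field_simp)
    exact k2.deriv
  have d2 : deriv (deriv m) 0 = r * deriv (deriv H) 0 := by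
    rw [d1]
    have k := ((hH'.differentiable (by norm_num) (r * 0)).hasDerivAt.comp 0
      ((hasDerivAt_id (0 : ℝ)).const_mul r))
    have k2 : HasDerivAt (fun x => deriv H (r * x)) (r * deriv (deriv H) 0) 0 :=
      k.congr_deriv (by rw [mul_zero]; ring)
    exact k2.deriv
  obtain ⟨e1, e2, e3⟩ := second_var hf r hm hl
  have := h r (m 0) (deriv m 0) (deriv (deriv m) 0) hr hrr e1 e2 e3
  rw [d2, ← mul_sub, abs_mul, abs_of_pos hr] at this
  have h5 : C * r ^ 5 = r * (C * r ^ 4) := by ring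
  rw [h5] at this
  exact le_of_mul_le_mul_left this hr

lemma dx_swap {F : ℝ × ℝ → ℝ} (hF : Sm F) : dx (fun p => F p.swap) = fun p => dy F p.swap := by
  have hs : Sm (fun p => F p.swap) := ContDiff.comp hF (contDiff_snd.prodMk contDiff_fst)
  funext ⟨a, b⟩
  exact (hs.hasDerivAt_fst a b).unique (hF.hasDerivAt_snd b a)

lemma dy_swap {F : ℝ × ℝ → ℝ} (hF : Sm F) : dy (fun p => F p.swap) = fun p => dx F p.swap := by
  have hs : Sm (fun p => F p.swap) := ContDiff.comp hF (contDiff_snd.prodMk contDiff_fst)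
  funext ⟨a, b⟩
  exact (hs.hasDerivAt_snd a b).unique (hF.hasDerivAt_fst b a)

lemma coef_sum {F : ℝ × ℝ → ℝ} (hF : Sm F) : coefA F + coefA (fun p => F p.swap)
    = (1 / 2) * ((dx (dx (dx (dx F))) 0 + 2 * dx (dx (dy (dy F))) 0 + dy (dy (dy (dy F))) 0)
      - 2 * (dx (dx F) 0 ^ 3 + 3 * dx (dx F) 0 * dx (dy F) 0 ^ 2
        + 3 * dy (dy F) 0 * dx (dy F) 0 ^ 2 + dy (dy F) 0 ^ 3)) := by
  have e1 : dx (fun p => F p.swap) = fun p => dy F p.swap := dx_swap hF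
  have e2 : dx (dx fun p => F p.swap) = fun p => dy (dy F) p.swap := by rw [e1, dx_swap hF.dy]
  have e3 : dx (dx (dx (dx fun p => F p.swap))) = fun p => dy (dy (dy (dy F))) p.swap := by
    rw [e2, dx_swap hF.dy.dy, dx_swap hF.dy.dy.dy]
  have e4 : dy (dy (dx (dx fun p => F p.swap))) = fun p => dx (dx (dy (dy F))) p.swap := by
    rw [e2, dy_swap hF.dy.dy, dy_swap hF.dy.dy.dx]
  have e5 : dx (dy fun p => F p.swap) = fun p => dy (dx F) p.swap := by
    rw [dy_swap hF, dx_swap hF.dx]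
  have e6 : dy (dy fun p => F p.swap) = fun p => dx (dx F) p.swap := by
    rw [dy_swap hF, dy_swap hF.dx]
  have e7 : dx (dx (dy (dy F))) = dy (dy (dx (dx F))) := by
    rw [hF.dy.dx_dy, hF.dx_dy, hF.dx.dy.dx_dy, hF.dx.dx_dy]
  unfold coefA
  rw [e3, e4, e2, e5, e6, ← hF.dx_dy, e7]
  simp only [Prod.swap_zero]
  ring

lemma swap_int {f : ℝ × ℝ → ℝ} (r y c : ℝ)
    (h : ∫ p : ℝ × ℝ, g (p.1 - 0) * g (p.2 - y) * ps (f (r • p) / r - c) = 0) :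
    ∫ p : ℝ × ℝ, g (p.1 - y) * g p.2 * ps (f (r • p).swap / r - c) = 0 := by
  rw [← h]
  have := integral_prod_swap (μ := (volume : Measure ℝ)) (ν := (volume : Measure ℝ))
    (fun p : ℝ × ℝ => g (p.1 - 0) * g (p.2 - y) * ps (f (r • p) / r - c))
  refine Eq.trans ?_ this
  congr 1; ext p
  simp only [Prod.fst_swap, Prod.snd_swap, sub_zero]
  rw [mul_comm (g p.2), show r • p.swap = (r • p).swap from rfl]

end MBO

/-- Expansion of the mean curvature of the half-time-step threshold dynamics interface:
`h_xx(0,0,t) + h_yy(0,0,t) = f_xx + f_yy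
  + (t/2)((f_xxxx + 2 f_xxyy + f_yyyy) − 2(f_xx³ + 3 f_xx f_xy² + 3 f_yy f_xy² + f_yy³)) + O(t²)`. -/
theorem mbo_half_step_curvature_expansion (f : ℝ → ℝ → ℝ)
    (hf : ContDiff ℝ (⊤ : ℕ∞) (fun p : ℝ × ℝ => f p.1 p.2))
    (h0 : f 0 0 = 0) (hfx : pdx f 0 0 = 0) (hfy : pdy f 0 0 = 0)
    (S : Set (ℝ × ℝ × ℝ)) (hS : S = {p : ℝ × ℝ × ℝ | p.2.2 ≤ f p.1 p.2.1})
    (ε : ℝ) (hε : 0 < ε) (h : ℝ → ℝ → ℝ → ℝ)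
    (hsmooth : ContDiffOn ℝ (⊤ : ℕ∞) (fun p : ℝ × ℝ × ℝ => h p.1 p.2.1 p.2.2)
      {p : ℝ × ℝ × ℝ | 0 < p.2.2})
    (hlevel : ∀ t ∈ Set.Ioo (0 : ℝ) ε, ∃ δ : ℝ, 0 < δ ∧ ∀ x y : ℝ, |x| < δ → |y| < δ →
      conv3 (t / 2) (Set.indicator S 1) (x, y, h x y t) = 1 / 2)
    (h00 : Filter.Tendsto (fun t => h 0 0 t) (nhdsWithin 0 (Set.Ioi 0)) (nhds 0)) :
    let fxx := pdx (pdx f) 0 0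
    let fyy := pdy (pdy f) 0 0
    let fxy := pdx (fun a b => pdy f a b) 0 0
    let fxxxx := pdx (pdx (pdx (pdx f))) 0 0
    let fxxyy := pdx (pdx (pdy (pdy f))) 0 0
    let fyyyy := pdy (pdy (pdy (pdy f))) 0 0
    ∃ C ε' : ℝ, 0 < ε' ∧ ∀ t ∈ Set.Ioo (0 : ℝ) ε',
      |pdx (pdx (fun a b => h a b t)) 0 0 + pdy (pdy (fun a b => h a b t)) 0 0
        - (fxx + fyy + (t / 2) * ((fxxxx + 2 * fxxyy + fyyyy)
          - 2 * (fxx ^ 3 + 3 * fxx * fxy ^ 2 + 3 * fyy * fxy ^ 2 + fyy ^ 3)))|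
        ≤ C * t ^ 2 := by
  intro fxx fyy fxy fxxxx fxxyy fyyyy
  set F : ℝ × ℝ → ℝ := fun p => f p.1 p.2 with hFdef
  have hF : MBO.Sm F := hf
  have cF : Continuous F := hf.continuous
  have hFs : MBO.Sm (fun p => F p.swap) := ContDiff.comp hF (contDiff_snd.prodMk contDiff_fst)
  have fF : f = fun a b => F (a, b) := rfl
  have px : pdx f = fun a b => MBO.dx F (a, b) := hF.pdx
  have py : pdy f = fun a b => MBO.dy F (a, b) := hF.pdy
  have z : ((0 : ℝ), (0 : ℝ)) = 0 := rfl
  have hx : MBO.dx F 0 = 0 := by rw [px] at hfx; exact hfx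
  have hy : MBO.dy F 0 = 0 := by rw [py] at hfy; exact hfy
  have e1 : fxx = MBO.dx (MBO.dx F) 0 := by
    simp only [fxx]; rw [px, hF.dx.pdx]; rfl
  have e2 : fyy = MBO.dy (MBO.dy F) 0 := by
    simp only [fyy]; rw [py, hF.dy.pdy]; rfl
  have e3 : fxy = MBO.dx (MBO.dy F) 0 := by
    simp only [fxy]; rw [py, hF.dy.pdx]; rfl
  have e4 : fxxxx = MBO.dx (MBO.dx (MBO.dx (MBO.dx F))) 0 := by
    simp only [fxxxx]; rw [px, hF.dx.pdx, hF.dx.dx.pdx, hF.dx.dx.dx.pdx]; rfl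
  have e5 : fxxyy = MBO.dx (MBO.dx (MBO.dy (MBO.dy F))) 0 := by
    simp only [fxxyy]; rw [py, hF.dy.pdy, hF.dy.dy.pdx, hF.dy.dy.dx.pdx]; rfl
  have e6 : fyyyy = MBO.dy (MBO.dy (MBO.dy (MBO.dy F))) 0 := by
    simp only [fyyyy]; rw [py, hF.dy.pdy, hF.dy.dy.pdy, hF.dy.dy.dy.pdy]; rfl
  obtain ⟨C1, r1, hC1, hr1, hr11, H1⟩ := MBO.onedim hF h0 hx hy
  obtain ⟨C2, r2, hC2, hr2, hr21, H2⟩ := MBO.onedim hFs h0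
    (by rw [MBO.dx_swap hF]; exact hy) (by rw [MBO.dy_swap hF]; exact hx)
  refine ⟨C1 + C2, min ε (min r1 r2 ^ 2), by positivity, fun t ht => ?_⟩
  have ht0 : 0 < t := ht.1
  have htε : t < ε := ht.2.trans_le (min_le_left _ _)
  have htr : t < min r1 r2 ^ 2 := ht.2.trans_le (min_le_right _ _)
  set r := √t with hrdef
  have hr : 0 < r := Real.sqrt_pos.2 ht0
  have hrt : r ^ 2 = t := Real.sq_sqrt ht0.le
  have hrm : r < min r1 r2 := by
    rw [hrdef, Real.sqrt_lt' (by positivity)]; exact htr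
  obtain ⟨δ, hδ, hlev⟩ := hlevel t ⟨ht0, htε⟩
  have hS' : S = {p : ℝ × ℝ × ℝ | p.2.2 ≤ F (p.1, p.2.1)} := hS
  have lev : ∀ x y : ℝ, |r * x| < δ → |r * y| < δ →
      ∫ p : ℝ × ℝ, MBO.g (p.1 - x) * MBO.g (p.2 - y)
        * MBO.ps (F (r • p) / r - h (r * x) (r * y) t / r) = 0 := by
    intro x y hx hy
    have k := hlev (r * x) (r * y) hx hy
    rw [hS', ← hrt] at k
    refine MBO.level_eq cF hr x y _ ?_
    rw [mul_div_cancel₀ _ hr.ne']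
    rw [hrt] at k ⊢
    exact k
  have ev : ∀ᶠ x in nhds (0 : ℝ), |r * x| < δ := by
    have : Continuous fun x : ℝ => |r * x| := by fun_prop
    exact this.continuousAt.eventually_lt_const (by simpa using hδ)
  have op : IsOpen {p : ℝ × ℝ × ℝ | 0 < p.2.2} :=
    isOpen_lt continuous_const (continuous_snd.comp continuous_snd)
  have smx : ContDiff ℝ (⊤ : ℕ∞) (fun x => h x 0 t) := by
    have : ContDiff ℝ (⊤ : ℕ∞) (fun x : ℝ => (x, (0 : ℝ), t)) := by fun_prop
    exact contDiffOn_univ.1 (hsmooth.comp this.contDiffOn fun x _ => ht0)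
  have smy : ContDiff ℝ (⊤ : ℕ∞) (fun y => h 0 y t) := by
    have : ContDiff ℝ (⊤ : ℕ∞) (fun y : ℝ => ((0 : ℝ), y, t)) := by fun_prop
    exact contDiffOn_univ.1 (hsmooth.comp this.contDiffOn fun x _ => ht0)
  have K1 := H1 r hr (hrm.trans_le (min_le_left _ _)) (fun x => h x 0 t) smx (by
    filter_upwards [ev] with x hx
    have := lev x 0 hx (by simpa using hδ)
    simpa only [mul_zero, sub_zero] using this)
  have K2 := H2 r hr (hrm.trans_le (min_le_right _ _)) (fun y => h 0 y t) smy (by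
    filter_upwards [ev] with y hy
    have := lev 0 y (by simpa using hδ) hy
    simp only [mul_zero] at this
    exact MBO.swap_int r y _ this)
  have e7 : MBO.dx (MBO.dx fun p => F p.swap) 0 = fyy := by
    rw [MBO.dx_swap hF, MBO.dx_swap hF.dy, e2]; rfl
  have hsum := MBO.coef_sum hF
  rw [← e1, ← e2, ← e3, ← e4, ← e5, ← e6] at hsum
  rw [e7] at K2
  rw [← e1] at K1
  have d1 : pdx (pdx (fun a b => h a b t)) 0 0 = deriv (deriv fun x => h x 0 t) 0 := rfl
  have d2 : pdy (pdy (fun a b => h a b t)) 0 0 = deriv (deriv fun y => h 0 y t) 0 := rfl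
  rw [d1, d2]
  have hr4 : r ^ 4 = t ^ 2 := by rw [← hrt]; ring
  rw [hr4, hrt] at K1 K2
  have key : deriv (deriv fun x => h x 0 t) 0 + deriv (deriv fun y => h 0 y t) 0
      - (fxx + fyy + (t / 2) * ((fxxxx + 2 * fxxyy + fyyyy)
          - 2 * (fxx ^ 3 + 3 * fxx * fxy ^ 2 + 3 * fyy * fxy ^ 2 + fyy ^ 3)))
      = (deriv (deriv fun x => h x 0 t) 0 - (fxx + t * MBO.coefA F))
        + (deriv (deriv fun y => h 0 y t) 0 - (fyy + t * MBO.coefA fun p => F p.swap)) := by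
    linear_combination t * hsum
  rw [key]
  refine (abs_add_le _ _).trans ?_
  linarith
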